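/- Let F_0, F_1, and F_2 be classes of unimodal Kripke frames (in pairwise disjoint signatures {0}, {1}, {2}) closed under isomorphic copies and disjoint unions. If ∘→∘ is a subframe of each of F_0, F_1, and F_2, then the μ-calculus' alternation hierarchy is strict over the fusion F_0 ⊗ F_1 ⊗ F_2: for every n ∈ ℕ there is a μ-formula in Σ^μ_{n+1} ∪ Π^μ_{n+1} which is not equivalent over F_0 ⊗ F_1 ⊗ F_2 to any μ-formula in Σ^μ_n ∪ Π^μ_n. -/

import Mathlib

/- ### μ-calculus: syntax and Kripke semantics -/

/-- μ-formulas over a modal signature `Λ`, with propositional symbols and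
variables indexed by `ℕ`; negation applies to propositional symbols only. -/
inductive MuForm (Λ : Type) : Type where
  | prop : ℕ → MuForm Λ
  | nprop : ℕ → MuForm Λ
  | var : ℕ → MuForm Λ
  | and : MuForm Λ → MuForm Λ → MuForm Λ
  | or : MuForm Λ → MuForm Λ → MuForm Λ
  | box : Λ → MuForm Λ → MuForm Λ
  | dia : Λ → MuForm Λ → MuForm Λ
  | mu : ℕ → MuForm Λ → MuForm Λ
  | nu : ℕ → MuForm Λ → MuForm Λ

/-- A Kripke model over signature `Λ` with set of worlds `W`. -/
structure KModel (Λ W : Type) where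
  R : Λ → W → W → Prop
  V : ℕ → Set W

namespace MuForm

variable {Λ W : Type}

/-- The valuation `‖φ‖^M` of a μ-formula, where `env` interprets the variables;
least and greatest fixed points are taken in the complete lattice `Set W`. -/
def sem (M : KModel Λ W) (env : ℕ → Set W) : MuForm Λ → Set W
  | prop p => M.V p
  | nprop p => (M.V p)ᶜ
  | var x => env x
  | and a b => sem M env a ∩ sem M env b
  | or a b => sem M env a ∪ sem M env b
  | box i a => {w | ∀ v, M.R i w v → v ∈ sem M env a}
  | dia i a => {w | ∃ v, M.R i w v ∧ v ∈ sem M env a}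
  | mu x a => sInf {A : Set W | sem M (Function.update env x A) a ⊆ A}
  | nu x a => sSup {A : Set W | A ⊆ sem M (Function.update env x A) a}

/-- Free variables of a μ-formula. -/
def freeVars : MuForm Λ → Set ℕ
  | prop _ => ∅
  | nprop _ => ∅
  | var x => {x}
  | and a b => freeVars a ∪ freeVars b
  | or a b => freeVars a ∪ freeVars b
  | box _ a => freeVars a
  | dia _ a => freeVars a
  | mu x a => freeVars a \ {x}
  | nu x a => freeVars a \ {x}

/-- A μ-formula contains no fixed-point operators. -/
def noFix : MuForm Λ → Prop
  | prop _ => True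
  | nprop _ => True
  | var _ => True
  | and a b => noFix a ∧ noFix b
  | or a b => noFix a ∧ noFix b
  | box _ a => noFix a
  | dia _ a => noFix a
  | mu _ _ => False
  | nu _ _ => False

/-- The list of subformulas of a μ-formula. -/
def subfs : MuForm Λ → List (MuForm Λ)
  | prop p => [prop p]
  | nprop p => [nprop p]
  | var x => [var x]
  | and a b => (and a b) :: (subfs a ++ subfs b)
  | or a b => (or a b) :: (subfs a ++ subfs b)
  | box i a => (box i a) :: subfs a
  | dia i a => (dia i a) :: subfs a
  | mu x a => (mu x a) :: subfs a
  | nu x a => (nu x a) :: subfs a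

/-- Substitution of `ψ` for the free occurrences of the variable `X`. -/
def subst (X : ℕ) (ψ : MuForm Λ) : MuForm Λ → MuForm Λ
  | prop p => prop p
  | nprop p => nprop p
  | var y => if y = X then ψ else var y
  | and a b => and (subst X ψ a) (subst X ψ b)
  | or a b => or (subst X ψ a) (subst X ψ b)
  | box i a => box i (subst X ψ a)
  | dia i a => dia i (subst X ψ a)
  | mu y a => if y = X then mu y a else mu y (subst X ψ a)
  | nu y a => if y = X then nu y a else nu y (subst X ψ a)

/-- The substitution of `ψ` for `X` is capture-free: no free variable of `ψ`
becomes bound when substituting `ψ` for the free occurrences of `X`. -/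
def CaptureFree (X : ℕ) (ψ : MuForm Λ) : MuForm Λ → Prop
  | prop _ => True
  | nprop _ => True
  | var _ => True
  | and a b => CaptureFree X ψ a ∧ CaptureFree X ψ b
  | or a b => CaptureFree X ψ a ∧ CaptureFree X ψ b
  | box _ a => CaptureFree X ψ a
  | dia _ a => CaptureFree X ψ a
  | mu y a => y = X ∨ ((X ∈ freeVars a → y ∉ freeVars ψ) ∧ CaptureFree X ψ a)
  | nu y a => y = X ∨ ((X ∈ freeVars a → y ∉ freeVars ψ) ∧ CaptureFree X ψ a)

/-- Number of occurrences of the variable `X`. -/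
def varCnt (X : ℕ) : MuForm Λ → ℕ
  | prop _ => 0
  | nprop _ => 0
  | var y => if y = X then 1 else 0
  | and a b => varCnt X a + varCnt X b
  | or a b => varCnt X a + varCnt X b
  | box _ a => varCnt X a
  | dia _ a => varCnt X a
  | mu _ a => varCnt X a
  | nu _ a => varCnt X a

/-- Number of fixed-point binders binding the variable `X`. -/
def bndCnt (X : ℕ) : MuForm Λ → ℕ
  | prop _ => 0
  | nprop _ => 0
  | var _ => 0
  | and a b => bndCnt X a + bndCnt X b
  | or a b => bndCnt X a + bndCnt X b
  | box _ a => bndCnt X a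
  | dia _ a => bndCnt X a
  | mu y a => (if y = X then 1 else 0) + bndCnt X a
  | nu y a => (if y = X then 1 else 0) + bndCnt X a

end MuForm

/-- Each variable has at most one occurrence, is bound by at most one
fixed-point operator, and no variable occurs free. -/
def WellNamed {Λ : Type} (φ : MuForm Λ) : Prop :=
  (∀ X : ℕ, MuForm.varCnt X φ ≤ 1 ∧ MuForm.bndCnt X φ ≤ 1) ∧ MuForm.freeVars φ = ∅

/- ### The alternation hierarchy Σ^μ_n / Π^μ_n -/

mutual
  /-- The class `Σ^μ_n` of the alternation hierarchy. -/
  inductive SigmaMu {Λ : Type} : ℕ → MuForm Λ → Prop where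
    | base {φ : MuForm Λ} : φ.noFix → SigmaMu 0 φ
    | upS {n : ℕ} {φ : MuForm Λ} : SigmaMu n φ → SigmaMu (n + 1) φ
    | upP {n : ℕ} {φ : MuForm Λ} : PiMu n φ → SigmaMu (n + 1) φ
    | andI {n : ℕ} {a b : MuForm Λ} :
        SigmaMu (n + 1) a → SigmaMu (n + 1) b → SigmaMu (n + 1) (MuForm.and a b)
    | orI {n : ℕ} {a b : MuForm Λ} :
        SigmaMu (n + 1) a → SigmaMu (n + 1) b → SigmaMu (n + 1) (MuForm.or a b)
    | boxI {n : ℕ} {i : Λ} {a : MuForm Λ} :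
        SigmaMu (n + 1) a → SigmaMu (n + 1) (MuForm.box i a)
    | diaI {n : ℕ} {i : Λ} {a : MuForm Λ} :
        SigmaMu (n + 1) a → SigmaMu (n + 1) (MuForm.dia i a)
    | muI {n : ℕ} {X : ℕ} {a : MuForm Λ} :
        SigmaMu (n + 1) a → SigmaMu (n + 1) (MuForm.mu X a)
    | substI {n : ℕ} {X : ℕ} {a ψ : MuForm Λ} :
        SigmaMu (n + 1) a → SigmaMu (n + 1) ψ → MuForm.CaptureFree X ψ a →
        SigmaMu (n + 1) (MuForm.subst X ψ a)

  /-- The class `Π^μ_n` of the alternation hierarchy. -/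
  inductive PiMu {Λ : Type} : ℕ → MuForm Λ → Prop where
    | base {φ : MuForm Λ} : φ.noFix → PiMu 0 φ
    | upS {n : ℕ} {φ : MuForm Λ} : SigmaMu n φ → PiMu (n + 1) φ
    | upP {n : ℕ} {φ : MuForm Λ} : PiMu n φ → PiMu (n + 1) φ
    | andI {n : ℕ} {a b : MuForm Λ} :
        PiMu (n + 1) a → PiMu (n + 1) b → PiMu (n + 1) (MuForm.and a b)
    | orI {n : ℕ} {a b : MuForm Λ} :
        PiMu (n + 1) a → PiMu (n + 1) b → PiMu (n + 1) (MuForm.or a b)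
    | boxI {n : ℕ} {i : Λ} {a : MuForm Λ} :
        PiMu (n + 1) a → PiMu (n + 1) (MuForm.box i a)
    | diaI {n : ℕ} {i : Λ} {a : MuForm Λ} :
        PiMu (n + 1) a → PiMu (n + 1) (MuForm.dia i a)
    | nuI {n : ℕ} {X : ℕ} {a : MuForm Λ} :
        PiMu (n + 1) a → PiMu (n + 1) (MuForm.nu X a)
    | substI {n : ℕ} {X : ℕ} {a ψ : MuForm Λ} :
        PiMu (n + 1) a → PiMu (n + 1) ψ → MuForm.CaptureFree X ψ a →
        PiMu (n + 1) (MuForm.subst X ψ a)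
end

/- ### Kripke frames, closure conditions, fusions, equivalence -/

/-- A Kripke frame over the signature `Λ`. -/
structure Frame (Λ : Type) : Type 1 where
  World : Type
  R : Λ → World → World → Prop

/-- Frame isomorphism. -/
def FrameIso {Λ : Type} (F G : Frame Λ) : Prop :=
  ∃ e : F.World ≃ G.World, ∀ (i : Λ) (w v : F.World), F.R i w v ↔ G.R i (e w) (e v)

/-- A class of frames is closed under isomorphic copies. -/
def ClosedUnderIso {Λ : Type} (C : Set (Frame Λ)) : Prop :=
  ∀ F ∈ C, ∀ G : Frame Λ, FrameIso F G → G ∈ C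

/-- Disjoint union of a family of frames. -/
def Frame.disjUnion {Λ ι : Type} (f : ι → Frame Λ) : Frame Λ where
  World := Σ i : ι, (f i).World
  R m x y :=
    ∃ h : x.1 = y.1, (f y.1).R m (cast (congrArg (fun i => (f i).World) h) x.2) y.2

/-- A class of frames is closed under disjoint unions. -/
def ClosedUnderDU {Λ : Type} (C : Set (Frame Λ)) : Prop :=
  ∀ (ι : Type) (f : ι → Frame Λ), (∀ i, f i ∈ C) → Frame.disjUnion f ∈ C

/-- `∘→∘` is a subframe of the class `C` of unimodal frames. -/
def HasEdge (C : Set (Frame Unit)) : Prop :=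
  ∃ F ∈ C, ∃ w0 w1 : F.World, w0 ≠ w1 ∧ F.R () w0 w1

/-- `∘←∘→∘` is a subframe of the class `C` of unimodal frames. -/
def HasFork (C : Set (Frame Unit)) : Prop :=
  ∃ F ∈ C, ∃ w0 w1 w2 : F.World,
    w0 ≠ w1 ∧ w0 ≠ w2 ∧ w1 ≠ w2 ∧ F.R () w0 w1 ∧ F.R () w0 w2

/-- `∘→∘→∘` is a subframe of the class `C` of unimodal frames. -/
def HasChain2 (C : Set (Frame Unit)) : Prop :=
  ∃ F ∈ C, ∃ w0 w1 w2 : F.World,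
    w0 ≠ w1 ∧ w0 ≠ w2 ∧ w1 ≠ w2 ∧ F.R () w0 w1 ∧ F.R () w1 w2

/-- The unimodal reduct of a bimodal frame. -/
def Frame.reduct2 (F : Frame (Fin 2)) (i : Fin 2) : Frame Unit :=
  ⟨F.World, fun _ => F.R i⟩

/-- Fusion of two classes of unimodal frames (signatures `{0}` and `{1}`). -/
def fusion2 (C0 C1 : Set (Frame Unit)) : Set (Frame (Fin 2)) :=
  {F | F.reduct2 0 ∈ C0 ∧ F.reduct2 1 ∈ C1}

/-- The unimodal reduct of a trimodal frame. -/
def Frame.reduct3 (F : Frame (Fin 3)) (i : Fin 3) : Frame Unit :=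
  ⟨F.World, fun _ => F.R i⟩

/-- Fusion of three classes of unimodal frames. -/
def fusion3 (C0 C1 C2 : Set (Frame Unit)) : Set (Frame (Fin 3)) :=
  {F | F.reduct3 0 ∈ C0 ∧ F.reduct3 1 ∈ C1 ∧ F.reduct3 2 ∈ C2}

/-- Two μ-formulas are equivalent over a class of frames: they have the same
valuation in every model based on a frame of the class. -/
def EquivOver {Λ : Type} (C : Set (Frame Λ)) (φ ψ : MuForm Λ) : Prop :=
  ∀ F ∈ C, ∀ (V : ℕ → Set F.World) (env : ℕ → Set F.World),
    MuForm.sem ⟨F.R, V⟩ env φ = MuForm.sem ⟨F.R, V⟩ env ψ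

/- ### Games, strategies, evaluation games, parity games -/

/-- A two-player game on a graph: positions owned by `ownV` belong to
Verifier/∃, the others to Refuter/∀; `winV` decides infinite plays.
A player who cannot move loses. -/
structure Game (Pos : Type) where
  init : Pos
  ownV : Pos → Prop
  move : Pos → Pos → Prop
  winV : (ℕ → Pos) → Prop

/-- The history (current position first) of an infinite play after `n` steps. -/
def histN {Pos : Type} (p : ℕ → Pos) (n : ℕ) : List Pos :=
  ((List.range (n + 1)).map p).reverse

/-- Finite histories (current position first) of plays in which the player
owning the `own`-positions follows the strategy `σ`. -/
inductive Game.Hist {Pos : Type} (G : Game Pos) (own : Pos → Prop)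
    (σ : List Pos → Pos) : List Pos → Prop where
  | init : Game.Hist G own σ [G.init]
  | smove {l : List Pos} {x : Pos} : Game.Hist G own σ (x :: l) → own x →
      G.move x (σ (x :: l)) → Game.Hist G own σ (σ (x :: l) :: x :: l)
  | omove {l : List Pos} {x y : Pos} : Game.Hist G own σ (x :: l) → ¬ own x →
      G.move x y → Game.Hist G own σ (y :: x :: l)

/-- The player owning the `own`-positions has a winning strategy:
a strategy which always provides a legal move at reachable own positions
(so the player is never stuck) and such that every infinite play following it
satisfies the winning condition `winO`; finite plays in which the opponent is
stuck are automatically won. -/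
def Game.WinsFor {Pos : Type} (G : Game Pos) (own : Pos → Prop)
    (winO : (ℕ → Pos) → Prop) : Prop :=
  ∃ σ : List Pos → Pos,
    (∀ (l : List Pos) (x : Pos), G.Hist own σ (x :: l) → own x →
      G.move x (σ (x :: l))) ∧
    (∀ p : ℕ → Pos, p 0 = G.init → (∀ n, G.move (p n) (p (n + 1))) →
      (∀ n, own (p n) → p (n + 1) = σ (histN p n)) → winO p)

/-- Verifier has a winning strategy. -/
def Game.VWins {Pos : Type} (G : Game Pos) : Prop := G.WinsFor G.ownV G.winV

/-- Refuter has a winning strategy. -/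
def Game.RWins {Pos : Type} (G : Game Pos) : Prop :=
  G.WinsFor (fun x => ¬ G.ownV x) (fun p => ¬ G.winV p)

/-- Ownership of positions in the evaluation game `𝒢(M, w ⊨ φ0)`:
Verifier owns disjunctions, diamonds, μ-formulas, μ-bound variables and
false literals. -/
def evalOwnV {Λ W : Type} (M : KModel Λ W) (φ0 : MuForm Λ) :
    MuForm Λ × W → Prop := fun q =>
  match q with
  | (.or _ _, _) => True
  | (.dia _ _, _) => True
  | (.mu _ _, _) => True
  | (.var X, _) => ∃ a : MuForm Λ, (MuForm.mu X a) ∈ φ0.subfs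
  | (.prop p, w) => w ∉ M.V p
  | (.nprop p, w) => w ∈ M.V p
  | _ => False

/-- Admissible moves in the evaluation game `𝒢(M, w ⊨ φ0)`. -/
def evalMove {Λ W : Type} (M : KModel Λ W) (φ0 : MuForm Λ) :
    MuForm Λ × W → MuForm Λ × W → Prop := fun q r =>
  match q with
  | (.and a b, w) => r = (a, w) ∨ r = (b, w)
  | (.or a b, w) => r = (a, w) ∨ r = (b, w)
  | (.box i a, w) => ∃ v, M.R i w v ∧ r = (a, v)
  | (.dia i a, w) => ∃ v, M.R i w v ∧ r = (a, v)
  | (.mu _ a, w) => r = (a, w)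
  | (.nu _ a, w) => r = (a, w)
  | (.var X, w) =>
      ∃ a : MuForm Λ,
        ((MuForm.mu X a) ∈ φ0.subfs ∧ r = (MuForm.mu X a, w)) ∨
        ((MuForm.nu X a) ∈ φ0.subfs ∧ r = (MuForm.nu X a, w))
  | (.prop _, _) => False
  | (.nprop _, _) => False

/-- The formula `ψ` labels infinitely many positions of the infinite run `p`. -/
def InfOccF {Λ W : Type} (p : ℕ → MuForm Λ × W) (ψ : MuForm Λ) : Prop :=
  ∀ n, ∃ m, n ≤ m ∧ (p m).1 = ψ

/-- Verifier wins an infinite run iff the outermost fixed-point subformula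
occurring infinitely often is a ν-formula. -/
def evalWinV {Λ W : Type} (p : ℕ → MuForm Λ × W) : Prop :=
  ∃ (X : ℕ) (a : MuForm Λ), InfOccF p (MuForm.nu X a) ∧
    ∀ χ : MuForm Λ, InfOccF p χ → χ ∈ (MuForm.nu X a).subfs

/-- The evaluation game `𝒢(M, w ⊨ φ)`. -/
def evalGame {Λ W : Type} (M : KModel Λ W) (w : W) (φ : MuForm Λ) :
    Game (MuForm Λ × W) where
  init := (φ, w)
  ownV := evalOwnV M φ
  move := evalMove M φ
  winV := evalWinV

/-- A parity game. -/
structure PGame : Type 1 where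
  Pos : Type
  ownE : Pos → Prop
  init : Pos
  E : Pos → Pos → Prop
  Ω : Pos → ℕ

/-- The parity `k` occurs infinitely often in the infinite play `p`. -/
def InfOccPar (P : PGame) (p : ℕ → P.Pos) (k : ℕ) : Prop :=
  ∀ n, ∃ m, n ≤ m ∧ P.Ω (p m) = k

/-- A parity game as a game: ∃ wins an infinite play iff the greatest parity
occurring infinitely often is even. -/
def PGame.toGame (P : PGame) : Game P.Pos where
  init := P.init
  ownV := P.ownE
  move := P.E
  winV := fun p => ∃ k, Even k ∧ InfOccPar P p k ∧ ∀ j, InfOccPar P p j → j ≤ k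

/-- Player ∃ wins the parity game. -/
def PGame.ExWins (P : PGame) : Prop := P.toGame.VWins

/-- Player ∀ wins the parity game. -/
def PGame.AWins (P : PGame) : Prop := P.toGame.RWins

/-- The parity of a fixed-point formula: `2(i+ε) − 1` for a μ-formula in
`Σ^μ_{2i+ε} \ Π^μ_{2i+ε}`, `2i` for a ν-formula in `Π^μ_{2i+ε} \ Σ^μ_{2i+ε}`,
and `0` for non fixed-point formulas. -/
noncomputable def fpParity {Λ : Type} : MuForm Λ → ℕ := fun φ =>
  match φ with
  | .mu _ _ =>
      (fun ℓ => if Even ℓ then ℓ - 1 else ℓ) (sInf {k | SigmaMu k φ ∧ ¬ PiMu k φ})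
  | .nu _ _ =>
      (fun ℓ => if Even ℓ then ℓ else ℓ - 1) (sInf {k | PiMu k φ ∧ ¬ SigmaMu k φ})
  | _ => 0

/-- The evaluation game `𝒢(M, w ⊨ φ)` presented as the parity game
`𝒢^P(M, w ⊨ φ)`. -/
noncomputable def evalPGame {Λ W : Type} (M : KModel Λ W) (w : W)
    (φ : MuForm Λ) : PGame where
  Pos := MuForm Λ × W
  ownE := evalOwnV M φ
  init := (φ, w)
  E := evalMove M φ
  Ω := fun q => fpParity q.1

/- ### Tree unfolding of a parity game -/

/-- Finite `E`-paths of a parity game starting at the initial position,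
presented as (last vertex, reversed list of earlier vertices). -/
inductive IsUPath (P : PGame) : P.Pos × List P.Pos → Prop where
  | init : IsUPath P (P.init, [])
  | cons {u : P.Pos} {t : List P.Pos} {v : P.Pos} :
      IsUPath P (u, t) → P.E u v → IsUPath P (v, u :: t)

/-- The tree unfolding of a parity game: positions are the finite `E`-paths
starting at the initial position, with ownership and parity inherited from
the last vertex. -/
def PGame.unfold (P : PGame) : PGame where
  Pos := {q : P.Pos × List P.Pos // IsUPath P q}
  ownE := fun q => P.ownE q.val.1
  init := ⟨(P.init, []), IsUPath.init⟩
  E := fun q r => r.val.2 = q.val.1 :: q.val.2 ∧ P.E q.val.1 r.val.1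
  Ω := fun q => P.Ω q.val.1

/- ### The Kripke encoding of parity games and the formulas W_n -/

/- Propositional indices used for the encoding:
`bd = 0`, `pos = 1`, `pre₀ = 2`, `nxt₀ = 3`, `pre₁ = 4`, `nxt₁ = 5`,
`P_∃ = 6`, `P_∀ = 7`, `P_j = 8 + j`. -/

/-- Worlds of the Kripke model encoding a parity game: a world `pos v` for
each position `v`, and intermediate choice/confirmation worlds `mid u u'`
for the edges. -/
inductive EncW (Pos : Type) : Type where
  | pos : Pos → EncW Pos
  | mid : Pos → Pos → EncW Pos

/-- Choice steps (`R₀`) of the encoding. -/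
def encR0 (P : PGame) : EncW P.Pos → EncW P.Pos → Prop
  | EncW.pos v, EncW.mid u u' => v = u ∧ P.E u u'
  | _, _ => False

/-- Confirmation steps (`R₁`) of the encoding. -/
def encR1 (P : PGame) : EncW P.Pos → EncW P.Pos → Prop
  | EncW.mid u u', EncW.pos v => v = u' ∧ P.E u u'
  | _, _ => False

/-- Valuation of the encoding. -/
def encV (P : PGame) : ℕ → Set (EncW P.Pos) := fun n =>
  if n = 0 then Set.univ                                         -- bd
  else if n = 1 then {x | ∃ v, x = EncW.pos v}                   -- pos
  else if n = 2 then {x | ∃ v, x = EncW.pos v}                   -- pre₀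
  else if n = 3 then {x | ∃ u u', x = EncW.mid u u'}             -- nxt₀
  else if n = 4 then {x | ∃ u u', x = EncW.mid u u'}             -- pre₁
  else if n = 5 then {x | ∃ v, x = EncW.pos v}                   -- nxt₁
  else if n = 6 then {x | ∃ v, x = EncW.pos v ∧ P.ownE v}        -- P_∃
  else if n = 7 then {x | ∃ v, x = EncW.pos v ∧ ¬ P.ownE v}      -- P_∀
  else {x | ∃ v, x = EncW.pos v ∧ P.Ω v = n - 8}                 -- P_{n-8}

/-- The bimodal Kripke model `P^K` encoding the parity game `P`. -/
def encModel (P : PGame) : KModel (Fin 2) (EncW P.Pos) where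
  R := fun i => if i = 0 then encR0 P else encR1 P
  V := encV P

/-- `♦φ := νY. pre₀ ∧ bd ∧ ◇₀(nxt₀ ∧ pre₁ ∧ bd ∧ ◇₁(nxt₁ ∧ bd ∧
((Y ∧ ¬pos) ∨ (φ ∧ pos))))`. -/
def DiamW (Y : ℕ) (φ : MuForm (Fin 2)) : MuForm (Fin 2) :=
  .nu Y (.and (.prop 2) (.and (.prop 0)
    (.dia 0 (.and (.prop 3) (.and (.prop 4) (.and (.prop 0)
      (.dia 1 (.and (.prop 5) (.and (.prop 0)
        (.or (.and (.var Y) (.nprop 1)) (.and φ (.prop 1))))))))))))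

/-- `■φ := νY. (pre₀ ∧ bd → □₀(nxt₀ ∧ pre₁ ∧ bd → □₁(nxt₁ ∧ bd →
((Y ∧ ¬pos) ∧ (φ ∧ pos)))))`, implications written disjunctively. -/
def BoxW (Y : ℕ) (φ : MuForm (Fin 2)) : MuForm (Fin 2) :=
  .nu Y (.or (.or (.nprop 2) (.nprop 0))
    (.box 0 (.or (.or (.nprop 3) (.or (.nprop 4) (.nprop 0)))
      (.box 1 (.or (.or (.nprop 5) (.nprop 0))
        (.and (.and (.var Y) (.nprop 1)) (.and φ (.prop 1))))))))

/-- The `j`-th disjunct `(P_j ∧ P_∃ ∧ ♦X_j) ∨ (P_j ∧ P_∀ ∧ ■X_j)`. -/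
def WDisj (Y j : ℕ) : MuForm (Fin 2) :=
  .or (.and (.prop (8 + j)) (.and (.prop 6) (DiamW Y (.var j))))
      (.and (.prop (8 + j)) (.and (.prop 7) (BoxW Y (.var j))))

/-- The disjunction `⋁_{0 ≤ j ≤ n} [(P_j ∧ P_∃ ∧ ♦X_j) ∨ (P_j ∧ P_∀ ∧ ■X_j)]`. -/
def WBody (Y : ℕ) : ℕ → MuForm (Fin 2)
  | 0 => WDisj Y 0
  | j + 1 => .or (WBody Y (j)) (WDisj Y (j + 1))

/-- The alternating block of binders `ηX_n … νX_2 μX_1 νX_0`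
(`νX_j` for even `j`, `μX_j` for odd `j`). -/
def WBind : ℕ → MuForm (Fin 2) → MuForm (Fin 2)
  | 0, φ => .nu 0 φ
  | j + 1, φ =>
      if Even (j + 1) then .nu (j + 1) (WBind j φ) else .mu (j + 1) (WBind j φ)

/-- The winning region formula
`W_n := ηX_n … νX_2 μX_1 νX_0. ⋁_{0≤j≤n} [(P_j ∧ P_∃ ∧ ♦X_j) ∨ (P_j ∧ P_∀ ∧ ■X_j)]`,
where the fresh variable `Y` of `♦`/`■` is `n + 1`. -/
def Wfml (n : ℕ) : MuForm (Fin 2) := WBind n (WBody (n + 1) n)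

/- ### Pointed bimodal models, restriction, isomorphisms, the map f_φ -/

/-- A pointed bimodal Kripke model. -/
structure PModel : Type 1 where
  World : Type
  R0 : World → World → Prop
  R1 : World → World → Prop
  V : ℕ → Set World
  pt : World

/-- The underlying bimodal Kripke model. -/
def PModel.toK (M : PModel) : KModel (Fin 2) M.World :=
  ⟨fun i => if i = 0 then M.R0 else M.R1, M.V⟩

/-- The edges of the graph of a pointed bimodal model. -/
def PModel.edge (M : PModel) (x y : M.World) : Prop := M.R0 x y ∨ M.R1 x y

/-- The graph of the model has no loops. -/
def PModel.Acyclic (M : PModel) : Prop :=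
  ∀ x : M.World, ¬ Relation.TransGen M.edge x x

/-- Reachability in at most `k` steps. -/
def stepsLe (M : PModel) : ℕ → M.World → M.World → Prop
  | 0 => fun x y => x = y
  | k + 1 => fun x y => stepsLe M k x y ∨ ∃ u, stepsLe M k x u ∧ M.edge u y

/-- The worlds at distance less than `n` from the distinguished point. -/
def PModel.ball (M : PModel) (n : ℕ) : Set M.World :=
  {v | ∃ k, k + 1 ≤ n ∧ stepsLe M k M.pt v}

/-- `e` is an isomorphism between the restrictions `(M↾n, w)` and `(M'↾n, w')`,
i.e. an `n`-isomorphism. -/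
structure IsNIso (M M' : PModel) (n : ℕ)
    (e : {x // x ∈ M.ball n} ≃ {x // x ∈ M'.ball n}) : Prop where
  pt : ∀ hx : M.pt ∈ M.ball n, (e ⟨M.pt, hx⟩).val = M'.pt
  r0 : ∀ x y : {x // x ∈ M.ball n}, M.R0 x.val y.val ↔ M'.R0 (e x).val (e y).val
  r1 : ∀ x y : {x // x ∈ M.ball n}, M.R1 x.val y.val ↔ M'.R1 (e x).val (e y).val
  vals : ∀ (p : ℕ) (x : {x // x ∈ M.ball n}), x.val ∈ M.V p ↔ (e x).val ∈ M'.V p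

/-- The pointed models are `n`-isomorphic. -/
def NIsomorphic (M M' : PModel) (n : ℕ) : Prop := ∃ e, IsNIso M M' n e

/-- `e` is an isomorphism of pointed bimodal models. -/
structure IsIsoP (M M' : PModel) (e : M.World ≃ M'.World) : Prop where
  pt : e M.pt = M'.pt
  r0 : ∀ x y : M.World, M.R0 x y ↔ M'.R0 (e x) (e y)
  r1 : ∀ x y : M.World, M.R1 x y ↔ M'.R1 (e x) (e y)
  vals : ∀ (p : ℕ) (x : M.World), x ∈ M.V p ↔ e x ∈ M'.V p

/-- The pointed models are isomorphic. -/
def IsomorphicP (M M' : PModel) : Prop := ∃ e, IsIsoP M M' e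

/-- The map `f_φ` sending a pointed bimodal model `(M, w)` to the pointed
Kripke model `(𝒢^K(M, w ⊨ φ), ⟨φ, w⟩)` representing its evaluation game,
where `𝒢^K(M, w ⊨ φ) = (𝒢^P(M, w ⊨ φ))^K`. -/
noncomputable def fGame (φ : MuForm (Fin 2)) (M : PModel) : PModel where
  World := EncW (MuForm (Fin 2) × M.World)
  R0 := encR0 (evalPGame M.toK M.pt φ)
  R1 := encR1 (evalPGame M.toK M.pt φ)
  V := encV (evalPGame M.toK M.pt φ)
  pt := EncW.pos (φ, M.pt)

/- ### Modal logics, fusions of logics, GLP -/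

/-- Modal formulas (no fixed points) over a signature `I`, with full
implication and falsum. -/
inductive MForm (I : Type) : Type where
  | prop : ℕ → MForm I
  | fls : MForm I
  | imp : MForm I → MForm I → MForm I
  | box : I → MForm I → MForm I

namespace MForm

variable {I : Type}

def neg (a : MForm I) : MForm I := a.imp .fls

def conj (a b : MForm I) : MForm I := (a.imp b.neg).neg

def diam (i : I) (a : MForm I) : MForm I := (MForm.box i a.neg).neg

def iff (a b : MForm I) : MForm I := conj (a.imp b) (b.imp a)

/-- Kripke semantics for modal formulas. -/
def semM {W : Type} (R : I → W → W → Prop) (V : ℕ → Set W) : MForm I → Set W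
  | prop p => V p
  | fls => ∅
  | imp a b => {w | w ∈ semM R V a → w ∈ semM R V b}
  | box i a => {w | ∀ v, R i w v → v ∈ semM R V a}

/-- Uniform substitution of formulas for propositional symbols. -/
def substP (σ : ℕ → MForm I) : MForm I → MForm I
  | prop p => σ p
  | fls => fls
  | imp a b => imp (substP σ a) (substP σ b)
  | box i a => box i (substP σ a)

/-- The formula only uses modalities from `S`. -/
def UsesOnly (S : Set I) : MForm I → Prop
  | prop _ => True
  | fls => True
  | imp a b => UsesOnly S a ∧ UsesOnly S b
  | box i a => i ∈ S ∧ UsesOnly S a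

/-- The propositional symbol `x` occurs in the formula. -/
def PropOccurs (x : ℕ) : MForm I → Prop
  | prop p => p = x
  | fls => False
  | imp a b => PropOccurs x a ∨ PropOccurs x b
  | box _ a => PropOccurs x a

/-- Every occurrence of the propositional symbol `x` is within the scope of
some modality. -/
def Guarded (x : ℕ) : MForm I → Prop
  | prop p => p ≠ x
  | fls => True
  | imp a b => Guarded x a ∧ Guarded x b
  | box _ _ => True

end MForm

/-- Propositional tautologies: formulas true under every boolean valuation
treating propositional symbols and boxed formulas as atoms. -/
def IsTaut {I : Type} (φ : MForm I) : Prop :=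
  ∀ val : MForm I → Prop, ¬ val .fls →
    (∀ a b : MForm I, val (a.imp b) ↔ (val a → val b)) → val φ

/-- A modal formula is valid on a frame: it holds at every world under
every valuation. -/
def ValidOn {I : Type} (F : Frame I) (φ : MForm I) : Prop :=
  ∀ (V : ℕ → Set F.World) (w : F.World), w ∈ MForm.semM F.R V φ

/-- `L` is a normal modal logic in the signature `S`. -/
structure IsNormalIn {I : Type} (S : Set I) (L : Set (MForm I)) : Prop where
  inSig : ∀ φ ∈ L, MForm.UsesOnly S φ
  taut : ∀ φ : MForm I, MForm.UsesOnly S φ → IsTaut φ → φ ∈ L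
  axK : ∀ i ∈ S, ∀ a b : MForm I, MForm.UsesOnly S a → MForm.UsesOnly S b →
    ((MForm.box i (a.imp b)).imp ((MForm.box i a).imp (MForm.box i b))) ∈ L
  mp : ∀ a b : MForm I, a ∈ L → (a.imp b) ∈ L → b ∈ L
  nec : ∀ i ∈ S, ∀ a : MForm I, a ∈ L → MForm.box i a ∈ L
  subst : ∀ σ : ℕ → MForm I, (∀ p, MForm.UsesOnly S (σ p)) →
    ∀ a ∈ L, a.substP σ ∈ L

/-- The fusion of a family of modal logics: the smallest normal modal logic
in the combined signature containing each of them. -/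
def FusionLogic {I J : Type} (Ls : J → Set (MForm I)) : Set (MForm I) :=
  ⋂₀ {L : Set (MForm I) | IsNormalIn Set.univ L ∧ ∀ j, Ls j ⊆ L}

/-- Extension of a frame for the `j`-th component signature to the full
signature (the other relations are empty; validity of formulas in the
component signature is unaffected). -/
def extendFrame {I J : Type} (c : I → J) (j : J)
    (F : Frame {i : I // c i = j}) : Frame I :=
  ⟨F.World, fun i w v => ∃ h : c i = j, F.R ⟨i, h⟩ w v⟩

/-- The reduct of a frame for the full signature to the `j`-th component. -/
def Frame.reductTo {I J : Type} (c : I → J) (j : J) (F : Frame I) :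
    Frame {i : I // c i = j} :=
  ⟨F.World, fun i => F.R i.val⟩

/-- `L` is characterized by the class `Fs` of frames in the `j`-th component
signature: `L` consists exactly of the formulas of that signature valid on
every frame of `Fs`. -/
def CharacterizedBy {I J : Type} (c : I → J) (j : J) (L : Set (MForm I))
    (Fs : Set (Frame {i : I // c i = j})) : Prop :=
  L = {φ | MForm.UsesOnly {i | c i = j} φ ∧
        ∀ F ∈ Fs, ValidOn (extendFrame c j F) φ}

/-- The fusion of classes of frames in pairwise disjoint signatures. -/
def FusionFrames {I J : Type} (c : I → J)
    (Fs : ∀ j : J, Set (Frame {i : I // c i = j})) : Set (Frame I) :=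
  {F | ∀ j, F.reductTo c j ∈ Fs j}

/-- The finite model property for a logic in signature `S`. -/
def HasFMP {I : Type} (S : Set I) (L : Set (MForm I)) : Prop :=
  ∀ φ : MForm I, MForm.UsesOnly S φ → φ ∉ L →
    ∃ (W : Type) (_ : Finite W) (R : I → W → W → Prop) (V : ℕ → Set W),
      (∀ ψ ∈ L, ∀ w : W, w ∈ MForm.semM R V ψ) ∧ ∃ w : W, w ∉ MForm.semM R V φ

/-- The provability logic `GLP` (signature `ℕ`). -/
inductive GLPthm : MForm ℕ → Prop where
  | taut {φ : MForm ℕ} : IsTaut φ → GLPthm φ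
  | axK (n : ℕ) (a b : MForm ℕ) :
      GLPthm ((MForm.box n (a.imp b)).imp ((MForm.box n a).imp (MForm.box n b)))
  | axLob (n : ℕ) (a : MForm ℕ) :
      GLPthm ((MForm.box n ((MForm.box n a).imp a)).imp (MForm.box n a))
  | axMono {m n : ℕ} (h : m ≤ n) (a : MForm ℕ) :
      GLPthm ((MForm.box m a).imp (MForm.box n a))
  | axStab {m n : ℕ} (h : m ≤ n) (a : MForm ℕ) :
      GLPthm ((MForm.box m a).imp (MForm.box n (MForm.box m a)))
  | axStabD {m n : ℕ} (h : m ≤ n) (a : MForm ℕ) :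
      GLPthm ((MForm.diam m a).imp (MForm.box n (MForm.diam m a)))
  | mp {a b : MForm ℕ} : GLPthm (a.imp b) → GLPthm a → GLPthm b
  | nec (n : ℕ) {a : MForm ℕ} : GLPthm a → GLPthm (MForm.box n a)
  | subst (σ : ℕ → MForm ℕ) {a : MForm ℕ} : GLPthm a → GLPthm (a.substP σ)

/- ### Frame classes for the standard modal logics -/

def FK : Set (Frame Unit) := Set.univ
def FK4 : Set (Frame Unit) := {F | Transitive (F.R ())}
def FS4 : Set (Frame Unit) := {F | Reflexive (F.R ()) ∧ Transitive (F.R ())}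
def FKD45 : Set (Frame Unit) :=
  {F | (∀ w, ∃ v, F.R () w v) ∧ Transitive (F.R ()) ∧
    (∀ w v u, F.R () w v → F.R () w u → F.R () v u)}
def FS5 : Set (Frame Unit) := {F | Equivalence (F.R ())}
def FGL : Set (Frame Unit) :=
  {F | Transitive (F.R ()) ∧ ¬ ∃ f : ℕ → F.World, ∀ k, F.R () (f k) (f (k + 1))}

namespace AHS

open MuForm

section basics
variable {Λ W : Type}

/-- Dual formula. -/
def dual : MuForm Λ → MuForm Λ
  | prop p => nprop p
  | nprop p => prop p
  | var x => var x
  | .and a b => .or (dual a) (dual b)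
  | .or a b => .and (dual a) (dual b)
  | box i a => dia i (dual a)
  | dia i a => box i (dual a)
  | mu x a => nu x (dual a)
  | nu x a => mu x (dual a)

theorem compl_update (env : ℕ → Set W) (x : ℕ) (A : Set W) :
    (fun y => ((Function.update env x A) y)ᶜ) = Function.update (fun y => (env y)ᶜ) x Aᶜ := by
  funext y
  by_cases h : y = x
  · subst h; simp
  · simp [Function.update_of_ne h]

theorem sem_dual (M : KModel Λ W) (a : MuForm Λ) : ∀ env : ℕ → Set W,
    sem M env (dual a) = (sem M (fun x => (env x)ᶜ) a)ᶜ := by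
  induction a with
  | prop p => intro env; simp [dual, sem]
  | nprop p => intro env; simp [dual, sem]
  | var x => intro env; simp [dual, sem]
  | and a b iha ihb => intro env; simp [dual, sem, iha, ihb, Set.compl_inter]
  | or a b iha ihb => intro env; simp [dual, sem, iha, ihb, Set.compl_union]
  | box i a ih => intro env; ext w; simp [dual, sem, ih]
  | dia i a ih => intro env; ext w; simp [dual, sem, ih]
  | mu x a ih =>
    intro env
    ext w
    simp only [dual, sem, ih, compl_update, Set.sSup_eq_sUnion, Set.sInf_eq_sInter,
      Set.mem_sUnion, Set.mem_compl_iff, Set.mem_sInter, Set.mem_ofPred_eq]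
    push Not
    constructor
    · rintro ⟨A, h, hw⟩
      exact ⟨Aᶜ, by rwa [Set.subset_compl_comm], by simpa using hw⟩
    · rintro ⟨A, h, hw⟩
      exact ⟨Aᶜ, by rw [compl_compl]; exact Set.compl_subset_compl.2 h, by simpa using hw⟩
  | nu x a ih =>
    intro env
    ext w
    simp only [dual, sem, ih, compl_update, Set.sSup_eq_sUnion, Set.sInf_eq_sInter,
      Set.mem_sUnion, Set.mem_compl_iff, Set.mem_sInter, Set.mem_ofPred_eq]
    push Not
    constructor
    · intro h A hA hw
      exact (h Aᶜ (by rw [compl_compl]; exact Set.compl_subset_compl.2 hA)) hw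
    · intro h A hA
      by_contra hw
      exact h Aᶜ (Set.compl_subset_comm.1 hA) hw

theorem freeVars_dual (a : MuForm Λ) : freeVars (dual a) = freeVars a := by
  induction a <;> simp_all [dual, freeVars]

theorem noFix_dual (a : MuForm Λ) : noFix a → noFix (dual a) := by
  induction a <;> simp_all [dual, noFix]

theorem subst_dual (X : ℕ) (ψ a : MuForm Λ) :
    dual (MuForm.subst X ψ a) = MuForm.subst X (dual ψ) (dual a) := by
  induction a with
  | var y => by_cases h : y = X <;> simp [dual, MuForm.subst, h]
  | mu y a ih => by_cases h : y = X <;> simp [dual, MuForm.subst, h, ih]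
  | nu y a ih => by_cases h : y = X <;> simp [dual, MuForm.subst, h, ih]
  | _ => simp_all [dual, MuForm.subst]

theorem captureFree_dual (X : ℕ) (ψ a : MuForm Λ) :
    CaptureFree X ψ a → CaptureFree X (dual ψ) (dual a) := by
  induction a with
  | mu y a ih => simp only [dual, CaptureFree, freeVars_dual]; tauto
  | nu y a ih => simp only [dual, CaptureFree, freeVars_dual]; tauto
  | _ => simp_all [dual, CaptureFree]

mutual
theorem sigma_dual {n : ℕ} {a : MuForm Λ} : SigmaMu n a → PiMu n (dual a)
  | .base h => .base (noFix_dual _ h)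
  | .upS h => .upP (sigma_dual h)
  | .upP h => .upS (pi_dual h)
  | .andI h1 h2 => .orI (sigma_dual h1) (sigma_dual h2)
  | .orI h1 h2 => .andI (sigma_dual h1) (sigma_dual h2)
  | .boxI h => .diaI (sigma_dual h)
  | .diaI h => .boxI (sigma_dual h)
  | .muI h => .nuI (sigma_dual h)
  | .substI h1 h2 h3 => by
      rw [subst_dual]
      exact .substI (sigma_dual h1) (sigma_dual h2) (captureFree_dual _ _ _ h3)
theorem pi_dual {n : ℕ} {a : MuForm Λ} : PiMu n a → SigmaMu n (dual a)
  | .base h => .base (noFix_dual _ h)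
  | .upS h => .upP (sigma_dual h)
  | .upP h => .upS (pi_dual h)
  | .andI h1 h2 => .orI (pi_dual h1) (pi_dual h2)
  | .orI h1 h2 => .andI (pi_dual h1) (pi_dual h2)
  | .boxI h => .diaI (pi_dual h)
  | .diaI h => .boxI (pi_dual h)
  | .nuI h => .muI (pi_dual h)
  | .substI h1 h2 h3 => by
      rw [subst_dual]
      exact .substI (pi_dual h1) (pi_dual h2) (captureFree_dual _ _ _ h3)
end

theorem sem_congr (M : KModel Λ W) (a : MuForm Λ) : ∀ env env' : ℕ → Set W,
    (∀ x ∈ freeVars a, env x = env' x) → sem M env a = sem M env' a := by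
  induction a with
  | prop p => intros; rfl
  | nprop p => intros; rfl
  | var x => intro e e' h; exact h x rfl
  | and a b iha ihb =>
    intro e e' h
    simp only [sem]
    rw [iha e e' (fun x hx => h x (Or.inl hx)), ihb e e' (fun x hx => h x (Or.inr hx))]
  | or a b iha ihb =>
    intro e e' h
    simp only [sem]
    rw [iha e e' (fun x hx => h x (Or.inl hx)), ihb e e' (fun x hx => h x (Or.inr hx))]
  | box i a ih => intro e e' h; simp only [sem]; rw [ih e e' h]
  | dia i a ih => intro e e' h; simp only [sem]; rw [ih e e' h]
  | mu y a ih =>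
    intro e e' h
    have : ∀ A, sem M (Function.update e y A) a = sem M (Function.update e' y A) a := by
      intro A
      apply ih
      intro x hx
      by_cases hy : x = y
      · subst hy; simp
      · simp [Function.update_of_ne hy, h x ⟨hx, hy⟩]
    simp only [sem, this]
  | nu y a ih =>
    intro e e' h
    have : ∀ A, sem M (Function.update e y A) a = sem M (Function.update e' y A) a := by
      intro A
      apply ih
      intro x hx
      by_cases hy : x = y
      · subst hy; simp
      · simp [Function.update_of_ne hy, h x ⟨hx, hy⟩]
    simp only [sem, this]

theorem sem_subst_aux (M : KModel Λ W) (X : ℕ) (ψ a : MuForm Λ) (y : ℕ) (hy : y ≠ X)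
    (h : X ∈ freeVars a → y ∉ freeVars ψ) (env : ℕ → Set W) (A : Set W) :
    sem M (Function.update (Function.update env y A) X (sem M (Function.update env y A) ψ)) a
      = sem M (Function.update (Function.update env X (sem M env ψ)) y A) a := by
  apply sem_congr
  intro x hx
  by_cases hxX : x = X
  · subst hxX
    rw [Function.update_self, Function.update_of_ne hy.symm, Function.update_self]
    apply sem_congr
    intro z hz
    have : z ≠ y := fun e => h hx (e ▸ hz)
    simp [Function.update_of_ne this]
  · rw [Function.update_of_ne hxX]
    by_cases hxy : x = y
    · subst hxy; simp
    · simp [Function.update_of_ne hxy, Function.update_of_ne hxX]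

theorem sem_subst (M : KModel Λ W) (X : ℕ) (ψ a : MuForm Λ) : CaptureFree X ψ a →
    ∀ env : ℕ → Set W, sem M env (MuForm.subst X ψ a)
      = sem M (Function.update env X (sem M env ψ)) a := by
  induction a with
  | prop p => intros; rfl
  | nprop p => intros; rfl
  | var y =>
    intro _ env
    by_cases h : y = X
    · subst h; simp [MuForm.subst, sem]
    · simp [MuForm.subst, sem, h]
  | and a b iha ihb => intro h env; simp only [MuForm.subst, sem, iha h.1, ihb h.2]
  | or a b iha ihb => intro h env; simp only [MuForm.subst, sem, iha h.1, ihb h.2]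
  | box i a ih => intro h env; simp only [MuForm.subst, sem, ih h]
  | dia i a ih => intro h env; simp only [MuForm.subst, sem, ih h]
  | mu y a ih =>
    intro h env
    by_cases hy : y = X
    · subst hy; simp [MuForm.subst, sem]
    · obtain ⟨h1, h2⟩ := h.resolve_left hy
      simp only [MuForm.subst, sem, hy, if_false, ih h2, sem_subst_aux M X ψ a y hy h1]
  | nu y a ih =>
    intro h env
    by_cases hy : y = X
    · subst hy; simp [MuForm.subst, sem]
    · obtain ⟨h1, h2⟩ := h.resolve_left hy
      simp only [MuForm.subst, sem, hy, if_false, ih h2, sem_subst_aux M X ψ a y hy h1]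

end basics

section fixpoints
variable {α β : Type}

/-- Least fixed point. -/
def lf (f : Set α → Set α) : Set α := sInf {A | f A ⊆ A}
/-- Greatest fixed point. -/
def gf (f : Set α → Set α) : Set α := sSup {A | A ⊆ f A}

theorem lf_le {f : Set α → Set α} {A : Set α} (h : f A ⊆ A) : lf f ⊆ A := sInf_le h
theorem le_gf {f : Set α → Set α} {A : Set α} (h : A ⊆ f A) : A ⊆ gf f := le_sSup (a := A) h

theorem lf_fix {f : Set α → Set α} (hf : Monotone f) : f (lf f) = lf f :=
  OrderHom.map_lfp ⟨f, hf⟩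
theorem gf_fix {f : Set α → Set α} (hf : Monotone f) : f (gf f) = gf f :=
  OrderHom.map_gfp ⟨f, hf⟩

theorem lf_mono {f g : Set α → Set α} (h : ∀ A, f A ⊆ g A) : lf f ⊆ lf g :=
  sInf_le_sInf (fun A (hA : g A ⊆ A) => (h A).trans hA)
theorem gf_mono {f g : Set α → Set α} (h : ∀ A, f A ⊆ g A) : gf f ⊆ gf g :=
  sSup_le_sSup (fun A (hA : A ⊆ f A) => hA.trans (h A))

/-- The fixed point of index `k`. -/
def fx (k : ℕ) (f : Set α → Set α) : Set α := if Even k then gf f else lf f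

theorem fx_fix {k : ℕ} {f : Set α → Set α} (hf : Monotone f) : f (fx k f) = fx k f := by
  unfold fx; split
  · exact gf_fix hf
  · exact lf_fix hf

theorem fx_mono {k : ℕ} {f g : Set α → Set α} (h : ∀ A, f A ⊆ g A) : fx k f ⊆ fx k g := by
  unfold fx; split
  · exact gf_mono h
  · exact lf_mono h

theorem fx_const {k : ℕ} (C : Set α) : fx k (fun _ : Set α => C) = C :=
  (fx_fix (k := k) (f := fun _ : Set α => C) (fun _ _ _ => subset_rfl)).symm

theorem fx_diag {k : ℕ} {H : Set α → Set α → Set α}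
    (hH : ∀ A A' B B', A ⊆ A' → B ⊆ B' → H A B ⊆ H A' B') :
    fx k (fun Y => H Y Y) = fx k (fun Y => fx k (H Y)) := by
  have m1 : Monotone (fun Y => H Y Y) := fun A B h => hH _ _ _ _ h h
  have m2 : ∀ Y, Monotone (H Y) := fun Y A B h => hH _ _ _ _ subset_rfl h
  have m3 : Monotone (fun Y => fx k (H Y)) :=
    fun A B h => fx_mono (fun Z => hH _ _ _ _ h subset_rfl)
  have e1 : H (fx k (fun Y => fx k (H Y))) (fx k (fun Y => fx k (H Y)))
      = fx k (fun Y => fx k (H Y)) := by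
    have h1 := fx_fix (k := k) m3
    have h2 := fx_fix (k := k) (m2 (fx k (fun Y => fx k (H Y))))
    rw [h1] at h2
    exact h2
  have e2 := fx_fix (k := k) m1
  by_cases hk : Even k
  · have hfx : ∀ f : Set α → Set α, fx k f = gf f := fun f => by simp [fx, hk]
    apply subset_antisymm
    · rw [hfx (fun Y => fx k (H Y))]
      apply le_gf
      rw [hfx (H _)]
      apply le_gf
      exact e2.ge
    · rw [hfx (fun Y => H Y Y)]
      apply le_gf
      exact e1.ge
  · have hfx : ∀ f : Set α → Set α, fx k f = lf f := fun f => by simp [fx, hk]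
    apply subset_antisymm
    · rw [hfx (fun Y => H Y Y)]
      apply lf_le
      exact e1.le
    · rw [hfx (fun Y => fx k (H Y))]
      apply lf_le
      rw [hfx (H _)]
      apply lf_le
      exact e2.le

theorem fx_roll {k : ℕ} {f : Set α → Set β} {g : Set β → Set α} (hf : Monotone f)
    (hg : Monotone g) : f (fx k (fun A => g (f A))) = fx k (fun B => f (g B)) := by
  unfold fx; split
  · exact OrderHom.map_gfp_comp ⟨f, hf⟩ ⟨g, hg⟩
  · exact OrderHom.map_lfp_comp ⟨f, hf⟩ ⟨g, hg⟩

/-- Nested fixed points: variables of index `< k` are bound, outermost `k-1`. -/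
def nest (T : (ℕ → Set α) → Set α) : ℕ → (ℕ → Set α) → Set α
  | 0, Z => T Z
  | k + 1, Z => fx k (fun Y => nest T k (Function.update Z k Y))

theorem update_le {Z Z' : ℕ → Set α} (h : ∀ j, Z j ⊆ Z' j) (k : ℕ) {A B : Set α} (hAB : A ⊆ B) :
    ∀ j, Function.update Z k A j ⊆ Function.update Z' k B j := by
  intro j
  by_cases hj : j = k
  · subst hj; simpa
  · simpa [Function.update_of_ne hj] using h j

/-- Monotonicity of an operator in its indexed argument. -/
def MonoT (T : (ℕ → Set α) → Set β) : Prop :=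
  ∀ Z Z', (∀ j, Z j ⊆ Z' j) → T Z ⊆ T Z'

theorem nest_mono {T T' : (ℕ → Set α) → Set α} (h : ∀ Z Z', (∀ j, Z j ⊆ Z' j) → T Z ⊆ T' Z')
    (k : ℕ) : ∀ Z Z', (∀ j, Z j ⊆ Z' j) → nest T k Z ⊆ nest T' k Z' := by
  induction k with
  | zero => exact h
  | succ k ih =>
    intro Z Z' hZ
    exact fx_mono (fun A => ih _ _ (update_le hZ k subset_rfl))

theorem nest_monoY {T : (ℕ → Set α) → Set α} (h : MonoT T) (k : ℕ) (Z : ℕ → Set α) (i : ℕ) :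
    Monotone (fun Y => nest T k (Function.update Z i Y)) :=
  fun _ _ hAB => nest_mono h k _ _ (update_le (fun _ => subset_rfl) i hAB)

theorem nest_unfold {T : (ℕ → Set α) → Set α} (h : MonoT T) (k : ℕ) : ∀ Z,
    nest T k Z = T (fun j => if j < k then nest T k Z else Z j) := by
  induction k with
  | zero => intro Z; simp [nest]
  | succ k ih =>
    intro Z
    have e := fx_fix (k := k) (nest_monoY h k Z k)
    have e2 : nest T k (Function.update Z k (nest T (k + 1) Z)) = nest T (k + 1) Z := e
    have e3 := ih (Function.update Z k (nest T (k + 1) Z))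
    rw [e2] at e3
    conv_lhs => rw [e3]
    congr 1
    funext j
    rcases lt_trichotomy j k with hj | hj | hj
    · simp [hj, Nat.lt_succ_of_lt hj]
    · subst hj; simp
    · have : j ≠ k := by omega
      have h1 : ¬ j < k := by omega
      have h2 : ¬ j < k + 1 := by omega
      simp [this, h1, h2]

theorem nest_congr {T : (ℕ → Set α) → Set α} {hi : ℕ}
    (h : ∀ Z Z', (∀ j < hi, Z j = Z' j) → T Z = T Z') (k : ℕ) : ∀ Z Z',
    (∀ j < hi, k ≤ j → Z j = Z' j) → nest T k Z = nest T k Z' := by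
  induction k with
  | zero => intro Z Z' hZ; exact h _ _ (fun j hj => hZ j hj (Nat.zero_le _))
  | succ k ih =>
    intro Z Z' hZ
    simp only [nest]
    congr 1
    funext Y
    apply ih
    intro j hj hk
    by_cases hjk : j = k
    · subst hjk; simp
    · simp [hjk, hZ j hj (by omega)]

/-- `Z` and `Z'` correspond to each other along the partial map `g`. -/
def Rel (g : α → β → Prop) (Z : Set α) (Z' : Set β) : Prop :=
  ∀ u p, g u p → (u ∈ Z ↔ p ∈ Z')

theorem fx_rel {g : α → β → Prop} (hg : ∀ u p p', g u p → g u p' → p = p') {k : ℕ}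
    {G : Set α → Set α} {G' : Set β → Set β} (hG : Monotone G) (hG' : Monotone G')
    (h : ∀ Z Z', Rel g Z Z' → Rel g (G Z) (G' Z')) : Rel g (fx k G) (fx k G') := by
  have e := fx_fix (k := k) hG
  have e' := fx_fix (k := k) hG'
  -- the two candidate pairs
  have r1 : Rel g {u | ∃ p, g u p ∧ p ∈ fx k G'} (fx k G') := by
    intro u p hup
    constructor
    · rintro ⟨p', h1, h2⟩; rwa [hg u p p' hup h1]
    · intro hp; exact ⟨p, hup, hp⟩
  have r2 : Rel g {u | ∀ p, g u p → p ∈ fx k G'} (fx k G') := by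
    intro u p hup
    constructor
    · intro h'; exact h' p hup
    · intro hp p' h1; rwa [hg u p' p h1 hup]
  have s1 := h _ _ r1
  have s2 := h _ _ r2
  rw [e'] at s1 s2
  have func : ∀ P : Set β, Rel g {u | ∃ p, g u p ∧ p ∈ P} P := by
    intro P u p hup
    constructor
    · rintro ⟨p', h1, h2⟩; rwa [hg u p p' hup h1]
    · intro hp; exact ⟨p, hup, hp⟩
  have func2 : ∀ P : Set β, Rel g {u | ∀ p, g u p → p ∈ P} P := by
    intro P u p hup
    constructor
    · intro h'; exact h' p hup
    · intro hp p' h1; rwa [hg u p' p h1 hup]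
  by_cases hk : Even k
  · intro u p hup
    constructor
    · intro hu
      have hsub : {p | ∃ u, g u p ∧ u ∈ fx k G} ⊆ gf G' := by
        apply le_gf
        rintro q ⟨v, hv, hvG⟩
        have hr := h _ _ (func2 {p | ∃ u, g u p ∧ u ∈ fx k G})
        rw [← hr v q hv]
        rw [← e] at hvG
        have hs : fx k G ⊆ {u | ∀ p, g u p → p ∈ {p | ∃ u, g u p ∧ u ∈ fx k G}} :=
          fun w hw r hr => ⟨w, hr, hw⟩
        exact hG hs hvG
      have : p ∈ gf G' := hsub ⟨u, hup, hu⟩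
      simpa [fx, hk] using this
    · intro hp
      have hsub : {u | ∃ p, g u p ∧ p ∈ fx k G'} ⊆ gf G := by
        apply le_gf
        rintro v ⟨q, hq, hqG⟩
        exact (s1 v q hq).2 hqG
      have : u ∈ gf G := hsub ⟨p, hup, hp⟩
      simpa [fx, hk] using this
  · intro u p hup
    constructor
    · intro hu
      have hsub : lf G ⊆ {u | ∀ p, g u p → p ∈ fx k G'} := by
        apply lf_le
        intro v hv q hq
        exact (s2 v q hq).1 hv
      have hu' : u ∈ lf G := by simpa [fx, hk] using hu
      exact hsub hu' p hup
    · intro hp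
      have hsub : lf G' ⊆ {p | ∀ u, g u p → u ∈ fx k G} := by
        apply lf_le
        intro q hq v hv
        have hr := h _ _ (func {p | ∀ u, g u p → u ∈ fx k G})
        rw [← hr v q hv] at hq
        rw [← e]
        refine hG ?_ hq
        rintro w ⟨r, hr1, hr2⟩
        exact hr2 w hr1
      have hp' : p ∈ lf G' := by simpa [fx, hk] using hp
      exact hsub hp' u hup

theorem nest_rel {g : α → β → Prop} (hg : ∀ u p p', g u p → g u p' → p = p') {K : ℕ}
    (Good : (ℕ → Set α) → (ℕ → Set β) → Prop)
    (hGood : ∀ Z Z' i Y Y', i < K → Good Z Z' →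
      Good (Function.update Z i Y) (Function.update Z' i Y'))
    {T : (ℕ → Set α) → Set α} {T' : (ℕ → Set β) → Set β} (hT : MonoT T) (hT' : MonoT T')
    (h : ∀ Z Z', Good Z Z' → (∀ j, Rel g (Z j) (Z' j)) → Rel g (T Z) (T' Z')) :
    ∀ k ≤ K, ∀ Z Z', Good Z Z' → (∀ j, Rel g (Z j) (Z' j)) →
      Rel g (nest T k Z) (nest T' k Z') := by
  intro k
  induction k with
  | zero => intro _; exact h
  | succ k ih =>
    intro hk Z Z' hZ hr
    apply fx_rel hg (nest_monoY hT k Z k) (nest_monoY hT' k Z' k)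
    intro Y Y' hY
    apply ih (by omega) _ _ (hGood _ _ _ _ _ (by omega) hZ)
    intro j
    by_cases hj : j = k
    · subst hj; simpa using hY
    · simpa [hj] using hr j

end fixpoints

end AHS


namespace AHS

open MuForm

section automata
variable {Λ W : Type}

/-- Transition conditions of an alternating parity automaton. -/
inductive Tr (Λ Q α : Type) : Type where
  | lit : ℕ → Bool → Tr Λ Q α
  | leaf : α → Tr Λ Q α
  | and : Q → Q → Tr Λ Q α
  | or : Q → Q → Tr Λ Q α
  | box : Λ → Q → Tr Λ Q α
  | dia : Λ → Q → Tr Λ Q α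

/-- One step semantics. -/
def stepA {Q α : Type} (M : KModel Λ W) (env : α → Set W) (x : W) (Z : Set (Q × W)) :
    Tr Λ Q α → Prop
  | .lit p b => (x ∈ M.V p ↔ b = true)
  | .leaf a => x ∈ env a
  | .and q r => (q, x) ∈ Z ∧ (r, x) ∈ Z
  | .or q r => (q, x) ∈ Z ∨ (r, x) ∈ Z
  | .box i q => ∀ v, M.R i x v → (q, v) ∈ Z
  | .dia i q => ∃ v, M.R i x v ∧ (q, v) ∈ Z

theorem stepA_mono {Q α : Type} {M : KModel Λ W} {env env' : α → Set W} {x : W}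
    {Z Z' : Set (Q × W)} (he : ∀ a, env a ⊆ env' a) (hZ : Z ⊆ Z') (t : Tr Λ Q α) :
    stepA M env x Z t → stepA M env' x Z' t := by
  cases t with
  | lit p b => exact id
  | leaf a => exact fun h => he a h
  | and q r => exact fun h => ⟨hZ h.1, hZ h.2⟩
  | or q r => exact fun h => h.imp (fun h => hZ h) (fun h => hZ h)
  | box i q => exact fun h v hv => hZ (h v hv)
  | dia i q => exact fun ⟨v, hv, h⟩ => ⟨v, hv, hZ h⟩

/-- Alternating parity automata with leaves in `α`. -/
structure Aut (Λ α : Type) : Type 1 where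
  Q : Type
  δ : Q → Tr Λ Q α
  Ω : Q → ℕ
  q0 : Q

/-- The operator of an automaton. -/
def Aut.T {α : Type} (A : Aut Λ α) (M : KModel Λ W) (env : α → Set W)
    (Z : ℕ → Set (A.Q × W)) : Set (A.Q × W) :=
  {p | stepA M env p.2 (Z (A.Ω p.1)) (A.δ p.1)}

theorem Aut.T_mono {α : Type} (A : Aut Λ α) (M : KModel Λ W) {env env' : α → Set W}
    (he : ∀ a, env a ⊆ env' a) : ∀ Z Z', (∀ j, Z j ⊆ Z' j) → A.T M env Z ⊆ A.T M env' Z' :=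
  fun _ _ hZ _ hp => stepA_mono he (hZ _) _ hp

theorem Aut.T_monoT {α : Type} (A : Aut Λ α) (M : KModel Λ W) (env : α → Set W) :
    MonoT (A.T M env) := A.T_mono M (fun _ => subset_rfl)

theorem Aut.T_local {α : Type} (A : Aut Λ α) (M : KModel Λ W) (env : α → Set W) {hi : ℕ}
    (h : ∀ q, A.Ω q < hi) : ∀ Z Z', (∀ j < hi, Z j = Z' j) → A.T M env Z = A.T M env Z' := by
  intro Z Z' hZ
  ext p
  show stepA M env p.2 (Z (A.Ω p.1)) (A.δ p.1) ↔ stepA M env p.2 (Z' (A.Ω p.1)) (A.δ p.1)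
  rw [hZ _ (h _)]

/-- The section of a set at the state `q`. -/
def sec {Q : Type} (q : Q) (Z : Set (Q × W)) : Set W := {x | (q, x) ∈ Z}

/-- The set accepted by an automaton. -/
def Aut.acc {α : Type} (A : Aut Λ α) (M : KModel Λ W) (env : α → Set W) (hi : ℕ)
    (Z : ℕ → Set (A.Q × W)) : Set W := sec A.q0 (nest (A.T M env) hi Z)

theorem sec_mono {Q : Type} (q : Q) : Monotone (sec (W := W) q) :=
  fun _ _ h _ hx => h hx

open Classical in
/-- Close an automaton under a fixed point of priority `k`. -/
@[reducible] noncomputable def fixAut (A : Aut Λ ℕ) (X k : ℕ) : Aut Λ ℕ where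
  Q := A.Q
  δ q := if A.δ q = .leaf X then .and A.q0 A.q0 else A.δ q
  Ω q := if A.δ q = .leaf X then k else A.Ω q
  q0 := A.q0

theorem fixAut_T (A : Aut Λ ℕ) (X k : ℕ) (M : KModel Λ W) (env : ℕ → Set W)
    (Z : ℕ → Set (A.Q × W)) :
    (fixAut A X k).T M env Z = A.T M (Function.update env X (sec A.q0 (Z k))) Z := by
  ext ⟨q, x⟩
  show stepA M env x (Z ((fixAut A X k).Ω q)) ((fixAut A X k).δ q) ↔
    stepA M (Function.update env X (sec A.q0 (Z k))) x (Z (A.Ω q)) (A.δ q)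
  by_cases h : A.δ q = .leaf X
  · simp only [fixAut, h, if_true, stepA, Function.update_self]
    exact and_self_iff
  · simp only [fixAut, h, if_false]
    revert h
    cases A.δ q with
    | leaf Y =>
      intro h
      have : Y ≠ X := fun e => h (by rw [e])
      simp [stepA, this]
    | _ => intro _; rfl

theorem fixAut_nest (A : Aut Λ ℕ) (X k : ℕ) (M : KModel Λ W) (env : ℕ → Set W) (j : ℕ) :
    j ≤ k → ∀ Z : ℕ → Set (A.Q × W),
    nest ((fixAut A X k).T M env) j Z
      = nest (A.T M (Function.update env X (sec A.q0 (Z k)))) j Z := by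
  induction j with
  | zero => intro _ Z; exact fixAut_T A X k M env Z
  | succ j ih =>
    intro hj Z
    show fx j _ = fx j _
    congr 1
    funext Y
    refine (ih (by omega) (Function.update Z j Y)).trans ?_
    rw [Function.update_of_ne (show k ≠ j by omega)]

theorem update_env_le {env : ℕ → Set W} {X : ℕ} {A B : Set W} (h : A ⊆ B) :
    ∀ a, Function.update env X A a ⊆ Function.update env X B a :=
  update_le (fun _ => subset_rfl) X h

theorem fixAut_acc (A : Aut Λ ℕ) (X k : ℕ) (M : KModel Λ W) (env : ℕ → Set W)
    (Z : ℕ → Set (A.Q × W)) :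
    (fixAut A X k).acc M env (k + 1) Z
      = fx k (fun Y => A.acc M (Function.update env X Y) (k + 1) Z) := by
  have e1 : nest ((fixAut A X k).T M env) (k + 1) Z
      = fx k (fun Y => nest (A.T M (Function.update env X (sec A.q0 Y))) k
          (Function.update Z k Y)) := by
    show fx k _ = fx k _
    congr 1
    funext Y
    refine (fixAut_nest A X k M env k le_rfl (Function.update Z k Y)).trans ?_
    rw [Function.update_self]
  have e2 := fx_diag (k := k) (H := fun Y1 Y2 =>
      nest (A.T M (Function.update env X (sec A.q0 Y1))) k (Function.update Z k Y2))
    (fun A1 A2 B1 B2 hA hB => nest_mono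
      (A.T_mono M (update_env_le (sec_mono _ hA))) k _ _
      (update_le (fun _ => subset_rfl) k hB))
  have e3 := fx_roll (k := k) (f := sec (W := W) A.q0)
    (g := fun B => nest (A.T M (Function.update env X B)) (k + 1) Z) (sec_mono _)
    (fun A1 A2 hA => nest_mono (A.T_mono M (update_env_le hA)) (k + 1) _ _
      (fun _ => subset_rfl))
  show sec A.q0 (nest ((fixAut A X k).T M env) (k + 1) Z) = _
  rw [e1, e2]
  exact e3

/-- Change of states in a transition condition. -/
def Tr.map {Q Q' α : Type} (f : Q → Q') : Tr Λ Q α → Tr Λ Q' α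
  | .lit p b => .lit p b
  | .leaf a => .leaf a
  | .and q r => .and (f q) (f r)
  | .or q r => .or (f q) (f r)
  | .box i q => .box i (f q)
  | .dia i q => .dia i (f q)

/-- Change of states, with leaves redirected. -/
def Tr.red {Q Q' α β : Type} (f : Q → Q') (s : α → Q') : Tr Λ Q α → Tr Λ Q' β
  | .lit p b => .lit p b
  | .leaf a => .and (s a) (s a)
  | .and q r => .and (f q) (f r)
  | .or q r => .or (f q) (f r)
  | .box i q => .box i (f q)
  | .dia i q => .dia i (f q)

/-- Priority of a state with leaves redirected. -/
def Tr.pr {Q α : Type} (k o : ℕ) : Tr Λ Q α → ℕ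
  | .leaf _ => k
  | _ => o

/-- Substitution of automata for leaves. -/
@[reducible] def bindAut {α β : Type} (A : Aut Λ α) (B : α → Aut Λ β) (k : ℕ) : Aut Λ β where
  Q := A.Q ⊕ (Σ a, (B a).Q)
  δ := fun s => match s with
    | .inl q => (A.δ q).red .inl (fun a => .inr ⟨a, (B a).q0⟩)
    | .inr q => ((B q.1).δ q.2).map (fun r => .inr ⟨q.1, r⟩)
  Ω := fun s => match s with
    | .inl q => (A.δ q).pr k (A.Ω q)
    | .inr q => (B q.1).Ω q.2
  q0 := .inl A.q0

theorem fx_tri {α β : Type} (ι : α → β) (hι : Function.Injective ι) {k : ℕ}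
    {G : Set β → Set β} (hG : Monotone G) {P : Set β → Set α → Set α}
    (hP : ∀ Y, Monotone (P Y)) (h : ∀ Y a, ι a ∈ G Y ↔ a ∈ P Y (ι ⁻¹' Y))
    (hloc : ∀ Y Y', (∀ b, (∀ a, ι a ≠ b) → (b ∈ Y ↔ b ∈ Y')) → P Y = P Y') :
    ι ⁻¹' (fx k G) = fx k (P (fx k G)) := by
  have e := fx_fix (k := k) hG
  have e' := fx_fix (k := k) (hP (fx k G))
  have h0 : ι ⁻¹' (fx k G) = P (fx k G) (ι ⁻¹' (fx k G)) := by
    ext a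
    rw [← h, e]
    rfl
  by_cases hk : Even k
  · apply subset_antisymm
    · have : ι ⁻¹' (fx k G) ⊆ gf (P (fx k G)) := le_gf h0.le
      simpa [fx, hk] using this
    · have hsub : fx k G ∪ ι '' (fx k (P (fx k G))) ⊆ gf G := by
        apply le_gf
        have hpre : ι ⁻¹' (fx k G ∪ ι '' (fx k (P (fx k G)))) = fx k (P (fx k G)) := by
          rw [Set.preimage_union, Set.preimage_image_eq _ hι, Set.union_eq_right]
          have : ι ⁻¹' (fx k G) ⊆ gf (P (fx k G)) := le_gf h0.le
          simpa [fx, hk] using this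
        have hl : P (fx k G ∪ ι '' (fx k (P (fx k G)))) = P (fx k G) := by
          apply hloc
          intro b hb
          constructor
          · rintro (hb' | ⟨a, _, ha⟩)
            · exact hb'
            · exact absurd ha (hb a)
          · exact fun hb' => Or.inl hb'
        rintro b (hb | ⟨a, ha, rfl⟩)
        · rw [← e] at hb
          exact hG Set.subset_union_left hb
        · rw [h, hpre, hl, e']
          exact ha
      intro a ha
      have : ι a ∈ gf G := hsub (Or.inr ⟨a, ha, rfl⟩)
      show ι a ∈ fx k G
      simpa [fx, hk] using this
  · have hle : fx k (P (fx k G)) ⊆ ι ⁻¹' (fx k G) := by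
      have : lf (P (fx k G)) ⊆ ι ⁻¹' (fx k G) := lf_le h0.ge
      simpa [fx, hk] using this
    apply subset_antisymm
    · have hsub : lf G ⊆ {b | b ∈ fx k G ∧ ∀ a, ι a = b → a ∈ fx k (P (fx k G))} := by
        apply lf_le
        have hpre : ι ⁻¹' {b | b ∈ fx k G ∧ ∀ a, ι a = b → a ∈ fx k (P (fx k G))}
            = fx k (P (fx k G)) := by
          ext a
          constructor
          · rintro ⟨_, h2⟩; exact h2 a rfl
          · intro ha
            exact ⟨hle ha, fun a' h' => by rwa [hι h']⟩
        have hl : P {b | b ∈ fx k G ∧ ∀ a, ι a = b → a ∈ fx k (P (fx k G))} = P (fx k G) := by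
          apply hloc
          intro b hb
          constructor
          · exact fun hb' => hb'.1
          · exact fun hb' => ⟨hb', fun a ha => absurd ha (hb a)⟩
        intro b hb
        refine ⟨?_, ?_⟩
        · rw [← e]
          have hs : {b | b ∈ fx k G ∧ ∀ a, ι a = b → a ∈ fx k (P (fx k G))} ⊆ fx k G :=
            fun c hc => hc.1
          exact hG hs hb
        · rintro a rfl
          rw [h, hpre, hl, e'] at hb
          exact hb
      intro a ha
      have ha' : ι a ∈ lf G := by
        have : ι a ∈ fx k G := ha
        simpa [fx, hk] using this
      exact (hsub ha').2 a rfl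
    · exact hle

theorem bindAut_inr {α β : Type} (A : Aut Λ α) (B : α → Aut Λ β) (k hi : ℕ)
    (M : KModel Λ W) (env : β → Set W) (Z : ℕ → Set ((bindAut A B k).Q × W)) (a : α)
    (q : (B a).Q) (x : W) :
    ((Sum.inr ⟨a, q⟩, x) ∈ nest ((bindAut A B k).T M env) hi Z) ↔
      (q, x) ∈ nest ((B a).T M env) hi
        (fun j => {p | ((Sum.inr ⟨a, p.1⟩, p.2) : (bindAut A B k).Q × W) ∈ Z j}) := by
  have := nest_rel (α := (B a).Q × W) (β := (bindAut A B k).Q × W)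
    (g := fun u p => p = (Sum.inr ⟨a, u.1⟩, u.2)) (by rintro u p p' rfl rfl; rfl) (K := hi)
    (fun _ _ => True) (by intros; trivial) ((B a).T_monoT M env)
    ((bindAut A B k).T_monoT M env)
    (by
      rintro Z Z' - hr ⟨q, x⟩ _ rfl
      show stepA M env x (Z ((B a).Ω q)) ((B a).δ q) ↔
        stepA M env x (Z' ((B a).Ω q)) (((B a).δ q).map (fun r => Sum.inr ⟨a, r⟩))
      have hr' : ∀ r v, ((r, v) ∈ Z ((B a).Ω q) ↔
          ((Sum.inr ⟨a, r⟩, v) : (bindAut A B k).Q × W) ∈ Z' ((B a).Ω q)) :=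
        fun r v => hr _ (r, v) _ rfl
      cases (B a).δ q <;> simp [stepA, Tr.map, hr'])
    hi le_rfl (fun j => {p | ((Sum.inr ⟨a, p.1⟩, p.2) : (bindAut A B k).Q × W) ∈ Z j}) Z trivial
    (by rintro j u p rfl; rfl)
  exact (this (q, x) _ rfl).symm

theorem bindAut_acc {α β : Type} (A : Aut Λ α) (B : α → Aut Λ β) (k : ℕ)
    (M : KModel Λ W) (env : β → Set W) (E : α → Set W)
    (hE : ∀ a Z, (B a).acc M env (k + 1) Z = E a) (Z : ℕ → Set ((bindAut A B k).Q × W)) :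
    ∃ Z', (bindAut A B k).acc M env (k + 1) Z = A.acc M E (k + 1) Z' := by
  let ι : A.Q × W → (bindAut A B k).Q × W := fun p => (Sum.inl p.1, p.2)
  have hι : Function.Injective ι := by
    rintro ⟨q, x⟩ ⟨q', x'⟩ h
    simp only [ι, Prod.mk.injEq, Sum.inl.injEq] at h
    exact Prod.ext h.1 h.2
  let eY : Set ((bindAut A B k).Q × W) → α → Set W :=
    fun Y a => {x | ((Sum.inr ⟨a, (B a).q0⟩, x) : (bindAut A B k).Q × W) ∈ Y}
  refine ⟨fun j => ι ⁻¹' (Z j), ?_⟩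
  have tri := fx_tri ι hι (k := k)
    (G := fun Y => nest ((bindAut A B k).T M env) k (Function.update Z k Y))
    (nest_monoY ((bindAut A B k).T_monoT M env) k Z k)
    (P := fun Y C => nest (A.T M (eY Y)) k (Function.update (fun j => ι ⁻¹' (Z j)) k C))
    (fun Y => nest_monoY (A.T_monoT M _) k _ k)
    (by
      intro Y p
      have := nest_rel (α := A.Q × W) (β := (bindAut A B k).Q × W)
        (g := fun u p => p = ι u) (by rintro u p p' rfl rfl; rfl) (K := k)
        (fun _ Z' => Z' k = Y)
        (by
          intro Z Z' i Y Y' hi h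
          rw [Function.update_of_ne (by omega)]; exact h)
        (A.T_monoT M (eY Y))
        ((bindAut A B k).T_monoT M env)
        (by
          rintro Z1 Z2 hY hr ⟨q, x⟩ _ rfl
          show stepA M (eY Y) x (Z1 (A.Ω q)) (A.δ q) ↔
            stepA M env x (Z2 ((A.δ q).pr k (A.Ω q)))
              ((A.δ q).red Sum.inl (fun a => Sum.inr ⟨a, (B a).q0⟩))
          have hr' : ∀ j r v, ((r, v) ∈ Z1 j ↔
              ((Sum.inl r, v) : (bindAut A B k).Q × W) ∈ Z2 j) :=
            fun j r v => hr _ (r, v) _ rfl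
          cases A.δ q with
          | leaf a => simp only [stepA, Tr.red, Tr.pr, hY, and_self]; rfl
          | _ => simp [stepA, Tr.red, Tr.pr, hr'])
        k le_rfl (Function.update (fun j => ι ⁻¹' (Z j)) k (ι ⁻¹' Y)) (Function.update Z k Y)
        (by simp)
        (by
          rintro j u p rfl
          by_cases hj : j = k
          · subst hj; simp
          · simp [hj])
      exact (this p _ rfl).symm)
    (by
      intro Y Y' h
      have : eY Y = eY Y' := by
        funext a
        ext x
        exact h _ (by rintro ⟨q, y⟩ h'; simp [ι] at h')
      simp only [this])
  have hEE : eY (nest ((bindAut A B k).T M env) (k + 1) Z) = E := by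
    funext a
    rw [← hE a (fun j => {p | ((Sum.inr ⟨a, p.1⟩, p.2) : (bindAut A B k).Q × W) ∈ Z j})]
    ext x
    exact bindAut_inr A B k (k + 1) M env Z a _ x
  have tri' : ι ⁻¹' (nest ((bindAut A B k).T M env) (k + 1) Z)
      = nest (A.T M (eY (nest ((bindAut A B k).T M env) (k + 1) Z))) (k + 1)
        (fun j => ι ⁻¹' (Z j)) := tri
  rw [hEE] at tri'
  ext x
  exact Set.ext_iff.1 tri' (A.q0, x)

/-- A one step automaton. -/
@[reducible] def oneAut {α : Type} (t : Tr Λ α α) : Aut Λ α where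
  Q := Option α
  δ := fun s => match s with
    | none => t.map some
    | some a => .leaf a
  Ω := fun _ => 0
  q0 := none

theorem oneAut_acc {α : Type} (t : Tr Λ α α) (k : ℕ) (M : KModel Λ W) (env : α → Set W) (Z) :
    (oneAut t).acc M env (k + 1) Z = {x | stepA M env x {p | p.2 ∈ env p.1} t} := by
  have hu := nest_unfold ((oneAut t).T_monoT M env) (k + 1) Z
  have key : ∀ s x, ((s, x) ∈ nest ((oneAut t).T M env) (k + 1) Z ↔
      stepA M env x (nest ((oneAut t).T M env) (k + 1) Z) ((oneAut t).δ s)) := by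
    intro s x
    conv_lhs => rw [hu]
    show stepA M env x (if 0 < k + 1 then nest ((oneAut t).T M env) (k + 1) Z else Z 0) _ ↔ _
    rw [if_pos (Nat.succ_pos k)]
  have key2 : ∀ a x, ((some a, x) ∈ nest ((oneAut t).T M env) (k + 1) Z ↔ x ∈ env a) :=
    fun a x => key (some a) x
  ext x
  refine (key none x).trans ?_
  show stepA M env x _ (t.map some) ↔ stepA M env x _ t
  cases t <;> simp [stepA, Tr.map, key2]

/-- `ψ` is represented by an automaton with priorities below `hi`. -/
def Rep (hi : ℕ) (ψ : MuForm Λ) : Prop :=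
  ∃ A : Aut Λ ℕ, (∀ q, A.Ω q < hi) ∧
    ∀ (W : Type) (M : KModel Λ W) (env : ℕ → Set W) (Z), A.acc M env hi Z = sem M env ψ

theorem bindAut_pr {α β : Type} (A : Aut Λ α) (B : α → Aut Λ β) (k : ℕ)
    (hA : ∀ q, A.Ω q < k + 1) (hB : ∀ a q, (B a).Ω q < k + 1) :
    ∀ q, (bindAut A B k).Ω q < k + 1 := by
  rintro (q | ⟨a, q⟩)
  · show (A.δ q).pr k (A.Ω q) < k + 1
    cases A.δ q <;> simp [Tr.pr] <;> exact Nat.lt_succ_iff.1 (hA q)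
  · exact hB a q

theorem rep_bind {α : Type} {k : ℕ} (A : Aut Λ α) (hA : ∀ q, A.Ω q < k + 1)
    (f : α → MuForm Λ) (hf : ∀ a, Rep (k + 1) (f a)) (ψ : MuForm Λ)
    (h : ∀ (W : Type) (M : KModel Λ W) (env : ℕ → Set W) (Z),
      A.acc M (fun a => sem M env (f a)) (k + 1) Z = sem M env ψ) : Rep (k + 1) ψ := by
  choose B hB1 hB2 using hf
  refine ⟨bindAut A B k, bindAut_pr A B k hA hB1, ?_⟩
  intro W M env Z
  obtain ⟨Z', hZ'⟩ := bindAut_acc A B k M env _ (fun a Z => hB2 a W M env Z) Z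
  rw [hZ', h]

theorem rep_prop (k p : ℕ) : Rep (k + 1) (prop p : MuForm Λ) := by
  refine ⟨oneAut (.lit p true), fun _ => Nat.succ_pos k, fun W M env Z => ?_⟩
  rw [oneAut_acc]; ext x; simp [stepA, sem]

theorem rep_nprop (k p : ℕ) : Rep (k + 1) (nprop p : MuForm Λ) := by
  refine ⟨oneAut (.lit p false), fun _ => Nat.succ_pos k, fun W M env Z => ?_⟩
  rw [oneAut_acc]; ext x; simp [stepA, sem]

theorem rep_var (k X : ℕ) : Rep (k + 1) (var X : MuForm Λ) := by
  refine ⟨oneAut (.leaf X), fun _ => Nat.succ_pos k, fun W M env Z => ?_⟩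
  rw [oneAut_acc]; ext x; simp [stepA, sem]

theorem rep_and {k : ℕ} {a b : MuForm Λ} (ha : Rep (k + 1) a) (hb : Rep (k + 1) b) :
    Rep (k + 1) (.and a b) := by
  refine rep_bind (α := Bool) (oneAut (.and true false)) (fun _ => Nat.succ_pos k)
    (fun c => if c then a else b) (by rintro (_ | _) <;> simpa) _ (fun W M env Z => ?_)
  rw [oneAut_acc]; ext x; simp [stepA, sem]

theorem rep_or {k : ℕ} {a b : MuForm Λ} (ha : Rep (k + 1) a) (hb : Rep (k + 1) b) :
    Rep (k + 1) (.or a b) := by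
  refine rep_bind (α := Bool) (oneAut (.or true false)) (fun _ => Nat.succ_pos k)
    (fun c => if c then a else b) (by rintro (_ | _) <;> simpa) _ (fun W M env Z => ?_)
  rw [oneAut_acc]; ext x; simp [stepA, sem]

theorem rep_box {k : ℕ} {i : Λ} {a : MuForm Λ} (ha : Rep (k + 1) a) :
    Rep (k + 1) (.box i a) := by
  refine rep_bind (α := Unit) (oneAut (.box i ())) (fun _ => Nat.succ_pos k)
    (fun _ => a) (fun _ => ha) _ (fun W M env Z => ?_)
  rw [oneAut_acc]; ext x; simp [stepA, sem]

theorem rep_dia {k : ℕ} {i : Λ} {a : MuForm Λ} (ha : Rep (k + 1) a) :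
    Rep (k + 1) (.dia i a) := by
  refine rep_bind (α := Unit) (oneAut (.dia i ())) (fun _ => Nat.succ_pos k)
    (fun _ => a) (fun _ => ha) _ (fun W M env Z => ?_)
  rw [oneAut_acc]; ext x; simp [stepA, sem]

theorem rep_subst {k X : ℕ} {a ψ : MuForm Λ} (ha : Rep (k + 1) a) (hψ : Rep (k + 1) ψ)
    (hc : CaptureFree X ψ a) : Rep (k + 1) (MuForm.subst X ψ a) := by
  obtain ⟨A, hA1, hA2⟩ := ha
  refine rep_bind A hA1 (fun Y => if Y = X then ψ else var Y) ?_ _ (fun W M env Z => ?_)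
  · intro Y
    by_cases h : Y = X
    · simpa [h] using hψ
    · simpa [h] using rep_var k Y
  · rw [hA2, sem_subst M X ψ a hc]
    congr 1
    funext Y
    by_cases h : Y = X
    · subst h; simp
    · simp [h, sem]

theorem rep_up {k : ℕ} {a : MuForm Λ} (ha : Rep k a) : Rep (k + 1) a := by
  obtain ⟨A, hA1, hA2⟩ := ha
  refine ⟨A, fun q => Nat.lt_succ_of_lt (hA1 q), fun W M env Z => ?_⟩
  rw [← hA2 W M env Z]
  unfold Aut.acc
  congr 1
  show fx k _ = _
  have : (fun Y => nest (A.T M env) k (Function.update Z k Y)) =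
      fun _ => nest (A.T M env) k Z := by
    funext Y
    apply nest_congr (A.T_local M env hA1)
    intro j h1 h2
    omega
  rw [this, fx_const]

theorem fixAut_pr (A : Aut Λ ℕ) (X k : ℕ) (hA : ∀ q, A.Ω q < k + 1) :
    ∀ q, (fixAut A X k).Ω q < k + 1 := by
  intro q
  simp only [fixAut]
  split
  · omega
  · exact hA q

theorem rep_mu {k X : ℕ} {a : MuForm Λ} (ha : Rep (k + 1) a) (hk : ¬ Even k) :
    Rep (k + 1) (.mu X a) := by
  obtain ⟨A, hA1, hA2⟩ := ha
  refine ⟨fixAut A X k, fixAut_pr A X k hA1, fun W M env Z => ?_⟩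
  rw [fixAut_acc]
  simp only [hA2, fx, hk, if_false]
  rfl

theorem rep_nu {k X : ℕ} {a : MuForm Λ} (ha : Rep (k + 1) a) (hk : Even k) :
    Rep (k + 1) (.nu X a) := by
  obtain ⟨A, hA1, hA2⟩ := ha
  refine ⟨fixAut A X k, fixAut_pr A X k hA1, fun W M env Z => ?_⟩
  rw [fixAut_acc]
  simp only [hA2, fx, hk, if_true]
  rfl

theorem rep_noFix {k : ℕ} (a : MuForm Λ) : noFix a → Rep (k + 1) a := by
  induction a with
  | prop p => intro _; exact rep_prop k p
  | nprop p => intro _; exact rep_nprop k p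
  | var p => intro _; exact rep_var k p
  | and a b iha ihb => intro h; exact rep_and (iha h.1) (ihb h.2)
  | or a b iha ihb => intro h; exact rep_or (iha h.1) (ihb h.2)
  | box i a ih => intro h; exact rep_box (ih h)
  | dia i a ih => intro h; exact rep_dia (ih h)
  | mu => intro h; exact h.elim
  | nu => intro h; exact h.elim

mutual
theorem sigma_rep {n : ℕ} {a : MuForm Λ} : SigmaMu n a → ∀ k, n ≤ k + 1 →
    (n = 0 ∨ ¬ Even k) → Rep (k + 1) a
  | .base h, k, _, _ => rep_noFix _ h
  | .upS h, k, hk, hp => sigma_rep h k (by omega) (Or.inr (by simpa using hp))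
  | .upP (n := m) h, k, hk, hp => by
      have hp' : ¬ Even k := by simpa using hp
      cases k with
      | zero => simp at hp'
      | succ k =>
        exact rep_up (pi_rep h k (by omega) (Or.inr (by rw [Nat.even_add_one] at hp'; tauto)))
  | .andI h1 h2, k, hk, hp => rep_and (sigma_rep h1 k hk hp) (sigma_rep h2 k hk hp)
  | .orI h1 h2, k, hk, hp => rep_or (sigma_rep h1 k hk hp) (sigma_rep h2 k hk hp)
  | .boxI h, k, hk, hp => rep_box (sigma_rep h k hk hp)
  | .diaI h, k, hk, hp => rep_dia (sigma_rep h k hk hp)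
  | .muI h, k, hk, hp => rep_mu (sigma_rep h k hk hp) (by simpa using hp)
  | .substI h1 h2 h3, k, hk, hp => rep_subst (sigma_rep h1 k hk hp) (sigma_rep h2 k hk hp) h3
theorem pi_rep {n : ℕ} {a : MuForm Λ} : PiMu n a → ∀ k, n ≤ k + 1 →
    (n = 0 ∨ Even k) → Rep (k + 1) a
  | .base h, k, _, _ => rep_noFix _ h
  | .upP h, k, hk, hp => pi_rep h k (by omega) (Or.inr (by simpa using hp))
  | .upS (n := m) h, k, hk, hp => by
      have hp' : Even k := by simpa using hp
      cases k with
      | zero => exact sigma_rep h 0 (by omega) (Or.inl (by omega))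
      | succ k =>
        exact rep_up (sigma_rep h k (by omega) (Or.inr (by rw [Nat.even_add_one] at hp'; tauto)))
  | .andI h1 h2, k, hk, hp => rep_and (pi_rep h1 k hk hp) (pi_rep h2 k hk hp)
  | .orI h1 h2, k, hk, hp => rep_or (pi_rep h1 k hk hp) (pi_rep h2 k hk hp)
  | .boxI h, k, hk, hp => rep_box (pi_rep h k hk hp)
  | .diaI h, k, hk, hp => rep_dia (pi_rep h k hk hp)
  | .nuI h, k, hk, hp => rep_nu (pi_rep h k hk hp) (by simpa using hp)
  | .substI h1 h2 h3, k, hk, hp => rep_subst (pi_rep h1 k hk hp) (pi_rep h2 k hk hp) h3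
end

theorem all_rep {n : ℕ} {a : MuForm Λ} (h : SigmaMu n a ∨ PiMu n a) : Rep (n + 1) a := by
  rcases h with h | h
  · by_cases hn : Even n
    · cases n with
      | zero => exact sigma_rep h 0 (by omega) (Or.inl rfl)
      | succ n => exact rep_up (sigma_rep h n le_rfl (Or.inr (by rw [Nat.even_add_one] at hn; tauto)))
    · exact sigma_rep h n (by omega) (Or.inr hn)
  · by_cases hn : Even n
    · exact pi_rep h n (by omega) (Or.inr hn)
    · cases n with
      | zero => exact pi_rep h 0 (by omega) (Or.inl rfl)
      | succ n => exact rep_up (pi_rep h n le_rfl (Or.inr (by rw [Nat.even_add_one] at hn; tauto)))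

/-- Representation by an automaton whose initial state is a conjunction. -/
theorem rep_start {k : ℕ} {a : MuForm Λ} (h : Rep (k + 1) a) :
    ∃ A : Aut Λ ℕ, (∀ q, A.Ω q < k + 1) ∧ (∃ q r, A.δ A.q0 = .and q r) ∧
    ∀ (W : Type) (M : KModel Λ W) (env : ℕ → Set W) (Z), A.acc M env (k + 1) Z = sem M env a := by
  obtain ⟨B, h1, h2⟩ := h
  refine ⟨bindAut (oneAut (.leaf ()) : Aut Λ Unit) (fun _ => B) k, ?_, ⟨_, _, rfl⟩, ?_⟩
  · exact bindAut_pr _ _ k (fun _ => Nat.succ_pos k) (fun _ => h1)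
  · intro W M env Z
    obtain ⟨Z', hZ'⟩ := bindAut_acc (oneAut (.leaf ()) : Aut Λ Unit) (fun _ => B) k M env
      (fun _ => sem M env a) (fun _ Z => h2 W M env Z) Z
    rw [hZ', oneAut_acc]
    rfl

end automata

end AHS


namespace AHS

open MuForm

/-- Data for the diagonal model. -/
structure Ctx : Type 1 where
  F : Fin 3 → Type
  FR : ∀ i, F i → F i → Prop
  w0 : ∀ i, F i
  w1 : ∀ i, F i
  hne : ∀ i, w0 i ≠ w1 i
  hR : ∀ i, FR i (w0 i) (w1 i)
  A : Aut (Fin 3) ℕ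

/-- Raw worlds. -/
inductive Raw (C : Ctx) : Type where
  | root : Raw C
  | dd : Raw C → (i : Fin 3) → C.F i → Raw C
  | lv : Raw C → (i : Fin 3) → C.F i → C.A.Q → Raw C → Raw C
  | hb : Raw C → (i : Fin 3) → C.F i → Fin 3 → C.A.Q → Raw C → Raw C

section raw
variable {C : Ctx}

def entry : Raw C → Option (Fin 3)
  | .root => none
  | .dd _ i _ => some i
  | .lv _ i _ _ _ => some i
  | .hb _ i _ _ _ _ => some i

def parent : Raw C → Raw C
  | .root => .root
  | .dd u _ _ => u
  | .lv u _ _ _ _ => u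
  | .hb u _ _ _ _ _ => u

def pos : Raw C → ∀ j, C.F j
  | .root => C.w0
  | .dd _ i y => Function.update C.w0 i y
  | .lv _ i y _ _ => Function.update C.w0 i y
  | .hb _ i y m _ x => Function.update (Function.update C.w0 m (pos x m)) i y

def base (u : Raw C) (i : Fin 3) : Raw C := if entry u = some i then parent u else u

theorem base_size (u : Raw C) (i : Fin 3) : sizeOf (base u i) ≤ sizeOf u := by
  unfold base
  split
  · cases u <;> simp [parent] <;> omega
  · exact le_rfl

/-- The shape of a transition. -/
def shape : Tr (Fin 3) C.A.Q ℕ → Option ((C.A.Q × C.A.Q) ⊕ (Fin 3 × C.A.Q))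
  | .lit _ _ => none
  | .leaf _ => none
  | .and q r => some (.inl (q, r))
  | .or q r => some (.inl (q, r))
  | .box m a => some (.inr (m, a))
  | .dia m a => some (.inr (m, a))

/-- An index different from both arguments. -/
def third (e m : Fin 3) : Fin 3 := if e = m then e + 1 else - (e + m)

theorem third_ne (e m : Fin 3) : third e m ≠ e ∧ third e m ≠ m := by
  revert e m; decide

open Classical in
noncomputable def childL (u : Raw C) (e : Fin 3) (q : C.A.Q) (x : Raw C) (i : Fin 3)
    (y : C.F i) : Raw C :=
  match shape (C.A.δ q) with
  | none => .dd u i y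
  | some (.inl (q1, q2)) =>
    if y = C.w1 i then
      if i = e + 1 then .lv u i y q1 x
      else if i = e + 2 then .lv u i y q2 x
      else .dd u i y
    else .dd u i y
  | some (.inr (m, a)) =>
    if y = C.w1 i ∧ i = third e m then .hb u i y m a x else .dd u i y

open Classical in
noncomputable def child : Raw C → (i : Fin 3) → C.F i → Raw C
  | .root, i, y => childL .root 0 C.A.q0 .root i y
  | .dd u e z, i, y => .dd (.dd u e z) i y
  | .lv u e z q x, i, y => childL (.lv u e z q x) e q x i y
  | .hb u e z m a x, i, y =>
    if i = m then
      .lv (.hb u e z m a x) i y a (if y = pos (base x i) i then base x i else child (base x i) i y)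
    else if y = C.w1 i ∧ C.FR m (pos x m) (pos x m) then .lv (.hb u e z m a x) i y a x
    else .dd (.hb u e z m a x) i y
termination_by u => sizeOf u
decreasing_by
  have := base_size x i
  simp
  omega

open Classical in
noncomputable def mk (c : Raw C) (i : Fin 3) (y : C.F i) : Raw C :=
  if y = pos c i then c else child c i y

theorem childL_cases (u : Raw C) (e : Fin 3) (q x i) (y : C.F i) :
    (childL u e q x i y = .dd u i y) ∨ (∃ q', childL u e q x i y = .lv u i y q' x) ∨
    (∃ m a, i ≠ m ∧ childL u e q x i y = .hb u i y m a x) := by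
  unfold childL
  split
  · simp
  · split_ifs <;> simp
  · split_ifs with h
    · refine Or.inr (Or.inr ⟨_, _, ?_, rfl⟩)
      rw [h.2]
      exact (third_ne _ _).2
    · simp

theorem child_cases (u : Raw C) (i) (y : C.F i) :
    (child u i y = .dd u i y) ∨ (∃ q x, child u i y = .lv u i y q x) ∨
    (∃ m a x, i ≠ m ∧ child u i y = .hb u i y m a x) := by
  cases u with
  | root =>
    rw [child]
    rcases childL_cases (.root : Raw C) 0 C.A.q0 .root i y with h | ⟨q, h⟩ | ⟨m, a, h, h'⟩
    · exact Or.inl h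
    · exact Or.inr (Or.inl ⟨_, _, h⟩)
    · exact Or.inr (Or.inr ⟨_, _, _, h, h'⟩)
  | dd => rw [child]; simp
  | lv u e z q x =>
    rw [child]
    rcases childL_cases (.lv u e z q x : Raw C) e q x i y with h | ⟨q, h⟩ | ⟨m, a, h, h'⟩
    · exact Or.inl h
    · exact Or.inr (Or.inl ⟨_, _, h⟩)
    · exact Or.inr (Or.inr ⟨_, _, _, h, h'⟩)
  | hb => rw [child]; split_ifs <;> simp

theorem entry_child (u : Raw C) (i) (y : C.F i) : entry (child u i y) = some i := by
  rcases child_cases u i y with h | ⟨q, x, h⟩ | ⟨m, a, x, h', h⟩ <;> rw [h] <;> rfl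

theorem parent_child (u : Raw C) (i) (y : C.F i) : parent (child u i y) = u := by
  rcases child_cases u i y with h | ⟨q, x, h⟩ | ⟨m, a, x, h', h⟩ <;> rw [h] <;> rfl

theorem pos_child (u : Raw C) (i) (y : C.F i) : pos (child u i y) i = y := by
  rcases child_cases u i y with h | ⟨q, x, h⟩ | ⟨m, a, x, h', h⟩ <;> rw [h] <;> simp [pos]

theorem base_child (u : Raw C) (i) (y : C.F i) : base (child u i y) i = u := by
  rw [base, if_pos (entry_child u i y), parent_child]

theorem base_of_ne {u : Raw C} {i} (h : entry u ≠ some i) : base u i = u := if_neg h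

inductive Valid : Raw C → Prop where
  | root : Valid .root
  | ch {u i y} : Valid u → entry u ≠ some i → y ≠ pos u i → Valid (child u i y)

theorem Valid.inv {u : Raw C} (h : Valid u) {i} (hi : entry u = some i) :
    Valid (parent u) ∧ entry (parent u) ≠ some i ∧ pos u i ≠ pos (parent u) i ∧
      child (parent u) i (pos u i) = u := by
  cases h with
  | root => simp [entry] at hi
  | @ch u j y h1 h2 h3 =>
    rw [entry_child] at hi
    obtain rfl : j = i := by simpa using hi
    rw [parent_child, pos_child]
    exact ⟨h1, h2, h3, rfl⟩

theorem valid_base {u : Raw C} (h : Valid u) (i) : Valid (base u i) := by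
  unfold base; split_ifs with h1
  · exact (h.inv h1).1
  · exact h

theorem entry_base {u : Raw C} (h : Valid u) (i) : entry (base u i) ≠ some i := by
  unfold base; split_ifs with h1
  · exact (h.inv h1).2.1
  · exact h1

theorem valid_mk {u : Raw C} (h : Valid u) {i} (hi : entry u ≠ some i) (y) : Valid (mk u i y) := by
  unfold mk; split_ifs with h1
  · exact h
  · exact .ch h hi h1

theorem base_mk {u : Raw C} {i} (hi : entry u ≠ some i) (y) : base (mk u i y) i = u := by
  unfold mk; split_ifs with h1
  · exact base_of_ne hi
  · exact base_child u i y

theorem pos_mk {u : Raw C} {i} (y) : pos (mk u i y) i = y := by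
  unfold mk; split_ifs with h1
  · exact h1.symm
  · exact pos_child u i y

theorem mk_base {u : Raw C} (h : Valid u) (i) : mk (base u i) i (pos u i) = u := by
  by_cases h1 : entry u = some i
  · obtain ⟨_, h2, h3, h4⟩ := h.inv h1
    rw [base, if_pos h1, mk, if_neg h3, h4]
  · rw [base_of_ne h1, mk, if_pos rfl]

theorem child_hub {u : Raw C} {e z m a x} {y : C.F m} :
    child (.hb u e z m a x) m y = .lv (.hb u e z m a x) m y a (mk (base x m) m y) := by
  rw [child, if_pos rfl, mk]

open Classical in
theorem child_hub_ne {u : Raw C} {e z m a x i} {y : C.F i} (h : i ≠ m) :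
    child (.hb u e z m a x) i y =
      if y = C.w1 i ∧ C.FR m (pos x m) (pos x m) then .lv (.hb u e z m a x) i y a x
    else .dd (.hb u e z m a x) i y := by
  rw [child, if_neg h]

/-- The world coded by a raw world. -/
def cod : Raw C → Raw C
  | .root => .root
  | .dd _ _ _ => .root
  | .lv _ _ _ _ x => x
  | .hb _ _ _ _ _ x => x

/-- Hubs are entered along a different index. -/
def hok : Raw C → Prop
  | .hb _ i _ m _ _ => i ≠ m
  | _ => True

theorem valid_cod {u : Raw C} (h : Valid u) : Valid (cod u) := by
  induction h with
  | root => exact .root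
  | @ch u i y h1 h2 h3 ih =>
    cases u with
    | root =>
      rw [child]
      rcases childL_cases (.root : Raw C) 0 C.A.q0 .root i y with h | ⟨q, h⟩ | ⟨m, a, h', h⟩ <;>
        rw [h] <;> exact .root
    | dd => rw [child]; exact .root
    | lv u e z q x =>
      rw [child]
      rcases childL_cases (.lv u e z q x : Raw C) e q x i y with h | ⟨q, h⟩ | ⟨m, a, h', h⟩ <;>
        rw [h]
      · exact .root
      · exact ih
      · exact ih
    | hb u e z m a x =>
      by_cases hm : i = m
      · subst hm
        rw [child_hub]
        exact valid_mk (valid_base ih _) (entry_base ih _) _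
      · rw [child_hub_ne hm]
        split_ifs
        · exact ih
        · exact .root

theorem valid_hok {u : Raw C} (h : Valid u) : hok u := by
  cases h with
  | root => trivial
  | @ch u i y h1 h2 h3 =>
    rcases child_cases u i y with h | ⟨q, x, h⟩ | ⟨m, a, x, h', h⟩ <;> rw [h]
    · trivial
    · trivial
    · exact h'

/-- Ownership by the existential player. -/
def own (v : ℕ → Prop) : Tr (Fin 3) C.A.Q ℕ → Prop
  | .lit p b => ¬ (v p ↔ b = true)
  | .leaf _ => True
  | .and _ _ => False
  | .or _ _ => True
  | .box _ _ => False
  | .dia _ _ => True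

/-- Valuation. -/
def val : Raw C → ℕ → Prop
  | .root => fun p => 7 ≤ p ∧ C.A.Ω C.A.q0 = p - 7
  | .dd _ _ _ => fun _ => False
  | .lv _ i _ q x => fun p => (p = 0 ∧ own (val x) (C.A.δ q)) ∨ (p = 1 + i.val) ∨
      (7 ≤ p ∧ C.A.Ω q = p - 7)
  | .hb _ i _ _ _ _ => fun p => p = 4 + i.val

def isE (i : Fin 3) : Raw C → Prop
  | .lv _ j _ _ _ => j = i
  | _ => False

def isH (i : Fin 3) : Raw C → Prop
  | .hb _ j _ _ _ _ => j = i
  | _ => False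

theorem val_E (i : Fin 3) (u : Raw C) : val u (1 + i.val) ↔ isE i u := by
  cases u with
  | root => simp [val, isE]; omega
  | dd => simp [val, isE]
  | lv u j y q x => simp only [val, isE, Fin.ext_iff]; omega
  | hb u j => simp [val, isE]; omega

theorem val_H (i : Fin 3) (u : Raw C) : val u (4 + i.val) ↔ isH i u := by
  cases u with
  | root => simp [val, isH]; omega
  | dd => simp [val, isH]
  | lv u j y q x => simp [val, isH]; omega
  | hb u j => simp only [val, isH, Fin.ext_iff]; omega

/-- State of a live world. -/
def live : Raw C → Option (C.A.Q × Raw C)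
  | .root => some (C.A.q0, .root)
  | .lv _ _ _ q x => some (q, x)
  | _ => none

def ent0 : Raw C → Fin 3
  | .lv _ i _ _ _ => i
  | _ => 0

theorem val_pr {u : Raw C} {q x} (h : live u = some (q, x)) (j : ℕ) :
    val u (7 + j) ↔ C.A.Ω q = j := by
  cases u with
  | root => simp [live] at h; simp [val, h.1]
  | dd => simp [live] at h
  | lv u i y q x => simp [live] at h; simp [val, h.1]; omega
  | hb => simp [live] at h

theorem val_own (hand : ∃ q r, C.A.δ C.A.q0 = .and q r) {u : Raw C} {q x}
    (h : live u = some (q, x)) : val u 0 ↔ own (val x) (C.A.δ q) := by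
  cases u with
  | root =>
    obtain ⟨q1, q2, hand⟩ := hand
    simp [live] at h; simp [val, ← h.1, hand, own]
  | dd => simp [live] at h
  | lv u i y q x => simp [live] at h; simp [val, h.1, h.2]; omega
  | hb => simp [live] at h

theorem live_child {u : Raw C} {q x} (h : live u = some (q, x)) (i) (y : C.F i) :
    child u i y = childL u (ent0 u) q x i y := by
  cases u with
  | root => simp [live] at h; rw [child, ← h.1, ← h.2]; rfl
  | dd => simp [live] at h
  | lv u i y q x => simp [live] at h; rw [child, ← h.1, ← h.2]; rfl
  | hb => simp [live] at h

theorem live_entry {u : Raw C} {q x} (h : live u = some (q, x)) {i} :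
    entry u ≠ some i ↔ ¬ isE i u := by
  cases u <;> simp_all [live, entry, isE]

theorem live_pos {u : Raw C} {q x} (h : live u = some (q, x)) {i} (hi : entry u ≠ some i) :
    pos u i = C.w0 i := by
  cases u with
  | lv u j y q x =>
    have : i ≠ j := fun e => hi (by rw [e]; rfl)
    simp [pos, this]
  | _ => simp_all [live, pos]

theorem live_ent0 {u : Raw C} {q x} (h : live u = some (q, x)) {i} (hi : i ≠ ent0 u) :
    entry u ≠ some i := by
  cases u with
  | lv u j y q x => intro h; simp [entry] at h; exact hi h.symm
  | _ => simp_all [live, entry]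

/-- The relations. -/
def RR (i : Fin 3) (u v : Raw C) : Prop := base u i = base v i ∧ C.FR i (pos u i) (pos v i)

/-- Composite successors. -/
def Sc (u v' : Raw C) : Prop :=
  ∃ i, ¬ isE i u ∧ ∃ v, Valid v ∧ RR i u v ∧
    ((isE i v ∧ v' = v) ∨ (isH i v ∧ ∃ m, ¬ isH m v ∧ RR m v v' ∧ isE m v'))

/-- Successors in the acceptance game. -/
def SuccA (t : Tr (Fin 3) C.A.Q ℕ) (x : Raw C) (p : C.A.Q × Raw C) : Prop :=
  match shape t with
  | none => False
  | some (.inl (q, r)) => p = (q, x) ∨ p = (r, x)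
  | some (.inr (m, a)) => p.1 = a ∧ RR m x p.2

theorem isE_entry {i} {u : Raw C} (h : isE i u) : entry u = some i := by
  cases u <;> simp_all [isE, entry]

theorem isH_entry {i} {u : Raw C} (h : isH i u) : entry u = some i := by
  cases u <;> simp_all [isH, entry]

/-- A neighbour entered along `i` is a child. -/
theorem RR_child {i} {u v : Raw C} (hv : Valid v) (hu : entry u ≠ some i)
    (hi : entry v = some i) (h : RR i u v) :
    child u i (pos v i) = v ∧ C.FR i (pos u i) (pos v i) ∧ pos v i ≠ pos u i := by
  obtain ⟨_, _, h3, h4⟩ := hv.inv hi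
  have : parent v = u := by
    have := h.1
    rw [base_of_ne hu, base, if_pos hi] at this
    exact this.symm
  rw [this] at h3 h4
  exact ⟨h4, h.2, h3⟩

theorem RR_of_child {i} {u : Raw C} (hu : entry u ≠ some i) {y} (h : C.FR i (pos u i) y) :
    RR i u (child u i y) := by
  refine ⟨?_, ?_⟩
  · rw [base_child, base_of_ne hu]
  · rw [pos_child]; exact h

theorem Sc_forth {u v' : Raw C} (hv' : Valid v') {q x} (h : live u = some (q, x))
    (hx : Valid x)
    (hs : Sc u v') : ∃ p, live v' = some p ∧ SuccA (C.A.δ q) x p := by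
  obtain ⟨i, hE, v, hv, hR, hcase⟩ := hs
  have hu := (live_entry h).2 hE
  have hi : entry v = some i := by
    rcases hcase with ⟨h, _⟩ | ⟨h, _⟩
    · exact isE_entry h
    · exact isH_entry h
  obtain ⟨hc, _, _⟩ := RR_child hv hu hi hR
  rw [live_child h] at hc
  unfold childL at hc
  unfold SuccA
  split at hc
  · rw [← hc] at hcase; simp [isE, isH] at hcase
  · rename_i q1 q2 _
    split_ifs at hc
    · rcases hcase with ⟨_, rfl⟩ | ⟨h, _⟩
      · rw [← hc]; exact ⟨_, rfl, Or.inl rfl⟩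
      · rw [← hc] at h; simp [isH] at h
    · rcases hcase with ⟨_, rfl⟩ | ⟨h, _⟩
      · rw [← hc]; exact ⟨_, rfl, Or.inr rfl⟩
      · rw [← hc] at h; simp [isH] at h
    · rw [← hc] at hcase; simp [isE, isH] at hcase
    · rw [← hc] at hcase; simp [isE, isH] at hcase
  · rename_i m a _
    split_ifs at hc with hc1
    · rcases hcase with ⟨h, _⟩ | ⟨_, m', hm', hR', hE'⟩
      · rw [← hc] at h; simp [isE] at h
      · have hok := valid_hok hv
        rw [← hc] at hok hm' hR'
        have him : i ≠ m := hok
        have him' : i ≠ m' := hm'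
        obtain ⟨h1, h2, h3⟩ := RR_child hv' (by simpa [entry] using him') (isE_entry hE') hR'
        by_cases hmm : m' = m
        · subst hmm
          rw [child_hub] at h1
          refine ⟨(a, mk (base x m') m' (pos v' m')), ?_, rfl, ?_, ?_⟩
          · rw [← h1]; simp [live, pos]
          · rw [base_mk (entry_base hx _)]
          · rw [pos_mk]
            simpa [pos, him'.symm] using h2
        · rw [child_hub_ne hmm] at h1
          split_ifs at h1 with h4
          · refine ⟨(a, x), ?_, rfl, rfl, h4.2⟩
            rw [← h1]; rfl
          · rw [← h1] at hE'; simp [isE] at hE'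
    · rw [← hc] at hcase; simp [isE, isH] at hcase

theorem Sc_back {u : Raw C} (hu : Valid u) {q x} (h : live u = some (q, x)) (hx : Valid x)
    {p} (hp : Valid p.2) (hs : SuccA (C.A.δ q) x p) :
    ∃ v', Valid v' ∧ live v' = some p ∧ Sc u v' := by
  have hstep : ∀ i, i ≠ ent0 u → Valid (child u i (C.w1 i)) ∧ RR i u (child u i (C.w1 i)) := by
    intro i hi
    have h1 := live_ent0 h hi
    refine ⟨.ch hu h1 ?_, RR_of_child h1 ?_⟩
    · rw [live_pos h h1]; exact (C.hne i).symm
    · rw [live_pos h h1]; exact C.hR i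
  have hnE : ∀ i, i ≠ ent0 u → ¬ isE i u := fun i hi => (live_entry h).1 (live_ent0 h hi)
  unfold SuccA at hs
  split at hs
  · exact hs.elim
  · rename_i q1 q2 hsh
    rcases hs with rfl | rfl
    · have hi : ent0 u + 1 ≠ ent0 u := by generalize ent0 u = e; revert e; decide
      have hc : child u (ent0 u + 1) (C.w1 _) = .lv u (ent0 u + 1) (C.w1 _) q1 x := by
        rw [live_child h]; unfold childL; rw [hsh]; simp
      refine ⟨_, (hstep _ hi).1, ?_, _, hnE _ hi, _, (hstep _ hi).1, (hstep _ hi).2,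
        Or.inl ⟨?_, rfl⟩⟩
      · rw [hc]; rfl
      · rw [hc]; rfl
    · have hi : ent0 u + 2 ≠ ent0 u := by generalize ent0 u = e; revert e; decide
      have hi' : ent0 u + 2 ≠ ent0 u + 1 := by generalize ent0 u = e; revert e; decide
      have hc : child u (ent0 u + 2) (C.w1 _) = .lv u (ent0 u + 2) (C.w1 _) q2 x := by
        rw [live_child h]; unfold childL; rw [hsh]; dsimp only
        rw [if_pos rfl, if_neg hi', if_pos rfl]
      refine ⟨_, (hstep _ hi).1, ?_, _, hnE _ hi, _, (hstep _ hi).1, (hstep _ hi).2,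
        Or.inl ⟨?_, rfl⟩⟩
      · rw [hc]; rfl
      · rw [hc]; rfl
  · rename_i m a hsh
    obtain ⟨pa, x'⟩ := p
    obtain ⟨rfl, hR⟩ := hs
    dsimp only at hR hp
    obtain ⟨hi, him⟩ := third_ne (ent0 u) m
    have hc : child u (third (ent0 u) m) (C.w1 _) = .hb u (third (ent0 u) m) (C.w1 _) m pa x := by
      rw [live_child h]; unfold childL; rw [hsh]; simp
    obtain ⟨hv, hRv⟩ := hstep _ hi
    have hnEi := hnE _ hi
    rw [hc] at hv hRv
    generalize third (ent0 u) m = i at *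
    have key : ∀ m' y, m' ≠ i → y ≠ pos (.hb u i (C.w1 i) m pa x : Raw C) m' →
        C.FR m' (pos (.hb u i (C.w1 i) m pa x : Raw C) m') y →
        ∀ X, child (.hb u i (C.w1 i) m pa x : Raw C) m' y =
          .lv (.hb u i (C.w1 i) m pa x) m' y pa X →
        ∃ v', Valid v' ∧ live v' = some (pa, X) ∧ Sc u v' := by
      intro m' y hm' hy hF X hX
      have he : entry (.hb u i (C.w1 i) m pa x : Raw C) ≠ some m' := by
        simpa [entry] using hm'.symm
      refine ⟨_, .ch hv he hy, ?_, i, hnEi, _, hv, hRv, Or.inr ⟨rfl, m', ?_, RR_of_child he hF, ?_⟩⟩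
      · rw [hX]; rfl
      · exact hm'.symm
      · rw [hX]; rfl
    have hpm : pos (.hb u i (C.w1 i) m pa x : Raw C) m = pos x m := by
      simp [pos, him.symm]
    by_cases hpp : pos x' m = pos x m
    · have hxx : x' = x := by
        rw [← mk_base hp m, ← mk_base hx m, hR.1, hpp]
      subst hxx
      obtain ⟨h1, h2⟩ := third_ne m i
      have hp0 : pos (.hb u i (C.w1 i) m pa x' : Raw C) (third m i) = C.w0 _ := by
        simp [pos, h1, h2]
      refine key (third m i) (C.w1 _) h2 ?_ ?_ _ ?_
      · rw [hp0]; exact (C.hne _).symm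
      · rw [hp0]; exact C.hR _
      · rw [child_hub_ne h1, if_pos ⟨rfl, hR.2⟩]
    · refine key m (pos x' m) him.symm ?_ ?_ _ ?_
      · rw [hpm]; exact hpp
      · rw [hpm]; exact hR.2
      · rw [child_hub, hR.1, mk_base hp]

end raw

end AHS


namespace AHS

open MuForm

/-- Monotonicity of the semantics. -/
theorem sem_monoE {Λ W : Type} (M : KModel Λ W) (a : MuForm Λ) :
    MonoT (fun Z : ℕ → Set W => sem M Z a) := by
  induction a with
  | prop p => intro Z Z' h; exact subset_rfl
  | nprop p => intro Z Z' h; exact subset_rfl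
  | var x => intro Z Z' h; exact h x
  | and a b iha ihb => intro Z Z' h; exact Set.inter_subset_inter (iha Z Z' h) (ihb Z Z' h)
  | or a b iha ihb => intro Z Z' h; exact Set.union_subset_union (iha Z Z' h) (ihb Z Z' h)
  | box i a ih => intro Z Z' h w hw v hv; exact ih Z Z' h (hw v hv)
  | dia i a ih => rintro Z Z' h w ⟨v, hv, hw⟩; exact ⟨v, hv, ih Z Z' h hw⟩
  | mu x a ih =>
    intro Z Z' h
    refine sInf_le_sInf ?_
    intro B hB
    exact (ih _ _ (update_le h x (subset_refl B))).trans hB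
  | nu x a ih =>
    intro Z Z' h
    refine sSup_le_sSup ?_
    intro B hB
    exact Set.Subset.trans hB (ih _ _ (update_le h x (subset_refl B)))

section formulas
variable {Λ W : Type}

def or3 (f : Fin 3 → MuForm Λ) : MuForm Λ := .or (f 0) (.or (f 1) (f 2))
def and3 (f : Fin 3 → MuForm Λ) : MuForm Λ := .and (f 0) (.and (f 1) (f 2))

theorem mem_or3 (M : KModel Λ W) (env) (f : Fin 3 → MuForm Λ) (w : W) :
    w ∈ sem M env (or3 f) ↔ ∃ i, w ∈ sem M env (f i) := by
  rw [Fin.exists_fin_succ, Fin.exists_fin_succ, Fin.exists_fin_one]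
  rfl

theorem mem_and3 (M : KModel Λ W) (env) (f : Fin 3 → MuForm Λ) (w : W) :
    w ∈ sem M env (and3 f) ↔ ∀ i, w ∈ sem M env (f i) := by
  rw [Fin.forall_fin_succ, Fin.forall_fin_succ, Fin.forall_fin_one]
  rfl

/-- The step formula. -/
def stepF (j : ℕ) : MuForm (Fin 3) :=
  .or
    (.and (.prop 0) (or3 fun i => .and (.nprop (1 + i.val)) (.dia i
      (.or (.and (.prop (1 + i.val)) (.var j))
        (.and (.prop (4 + i.val)) (or3 fun m => .and (.nprop (4 + m.val))
          (.dia m (.and (.prop (1 + m.val)) (.var j)))))))))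
    (.and (.nprop 0) (and3 fun i => .or (.prop (1 + i.val)) (.box i
      (.and (.or (.nprop (1 + i.val)) (.var j))
        (.or (.nprop (4 + i.val)) (and3 fun m => .or (.prop (4 + m.val))
          (.box m (.or (.nprop (1 + m.val)) (.var j)))))))))

def bodyF : ℕ → MuForm (Fin 3)
  | 0 => .and (.prop (7 + 0)) (stepF 0)
  | k + 1 => .or (bodyF k) (.and (.prop (7 + (k + 1))) (stepF (k + 1)))

theorem stepF_noFix (j : ℕ) : noFix (stepF j) := by
  simp [stepF, or3, and3, noFix]

theorem bodyF_noFix (n : ℕ) : noFix (bodyF n) := by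
  induction n with
  | zero => exact ⟨trivial, stepF_noFix 0⟩
  | succ k ih => exact ⟨ih, trivial, stepF_noFix _⟩

theorem mem_bodyF (M : KModel (Fin 3) W) (env) (n : ℕ) (w : W) :
    w ∈ sem M env (bodyF n) ↔ ∃ j ≤ n, w ∈ M.V (7 + j) ∧ w ∈ sem M env (stepF j) := by
  induction n with
  | zero =>
    constructor
    · intro h; exact ⟨0, le_rfl, h⟩
    · rintro ⟨j, hj, h⟩
      obtain rfl : j = 0 := by omega
      exact h
  | succ k ih =>
    constructor
    · rintro (h | h)
      · obtain ⟨j, hj, h⟩ := ih.1 h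
        exact ⟨j, by omega, h⟩
      · exact ⟨k + 1, le_rfl, h⟩
    · rintro ⟨j, hj, h⟩
      by_cases hjk : j ≤ k
      · exact Or.inl (ih.2 ⟨j, hjk, h⟩)
      · obtain rfl : j = k + 1 := by omega
        exact Or.inr h

def bindF (φ : MuForm (Fin 3)) : ℕ → MuForm (Fin 3)
  | 0 => φ
  | k + 1 => if Even k then .nu k (bindF φ k) else .mu k (bindF φ k)

theorem sem_bindF (M : KModel (Fin 3) W) (φ) (k : ℕ) : ∀ env,
    sem M env (bindF φ k) = nest (fun Z => sem M Z φ) k env := by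
  induction k with
  | zero => intro env; rfl
  | succ k ih =>
    intro env
    by_cases hk : Even k
    · simp only [bindF, nest, fx, hk, if_true, ← ih]; rfl
    · simp only [bindF, nest, fx, hk, if_false, ← ih]; rfl

theorem bindF_class {φ : MuForm (Fin 3)} (h : noFix φ) (k : ℕ) :
    (Even k → PiMu (k + 1) (bindF φ (k + 1))) ∧ (¬ Even k → SigmaMu (k + 1) (bindF φ (k + 1))) := by
  induction k with
  | zero =>
    refine ⟨fun _ => ?_, fun h => absurd Even.zero h⟩
    exact .nuI (.upP (.base h))
  | succ k ih =>
    constructor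
    · intro hk
      have hk' : ¬ Even k := by rwa [Nat.even_add_one] at hk
      rw [bindF, if_pos hk]
      exact .nuI (.upS (ih.2 hk'))
    · intro hk
      have hk' : Even k := by rw [Nat.even_add_one] at hk; tauto
      rw [bindF, if_neg hk]
      exact .muI (.upP (ih.1 hk'))

end formulas

section model
variable (C : Ctx)

abbrev NW : Type := {u : Raw C // Valid u}

def NM : KModel (Fin 3) (NW C) where
  R i u v := RR i u.1 v.1
  V p := {u | val u.1 p}

variable {C}

theorem mem_stepF (u : NW C) (env : ℕ → Set (NW C)) (j : ℕ) :
    u ∈ sem (NM C) env (stepF j) ↔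
      (val u.1 0 ∧ ∃ v' : NW C, Sc u.1 v'.1 ∧ v' ∈ env j) ∨
      (¬ val u.1 0 ∧ ∀ v' : NW C, Sc u.1 v'.1 → v' ∈ env j) := by
  have hV : ∀ (w : NW C) p, w ∈ (NM C).V p ↔ val w.1 p := fun _ _ => Iff.rfl
  have hRR : ∀ i (w v : NW C), (NM C).R i w v ↔ RR i w.1 v.1 := fun _ _ _ => Iff.rfl
  unfold stepF
  refine or_congr (and_congr (hV u 0) ?_) (and_congr (not_congr (hV u 0)) ?_)
  · rw [mem_or3]
    constructor
    · rintro ⟨i, h1, v, h2, ⟨h3, h4⟩ | ⟨h3, h4⟩⟩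
      · exact ⟨v, ⟨i, fun h => h1 ((val_E i _).2 h), v.1, v.2, h2,
          Or.inl ⟨(val_E i _).1 h3, rfl⟩⟩, h4⟩
      · rw [mem_or3] at h4
        obtain ⟨m, h5, v', h6, h7, h8⟩ := h4
        exact ⟨v', ⟨i, fun h => h1 ((val_E i _).2 h), v.1, v.2, h2,
          Or.inr ⟨(val_H i _).1 h3, m, fun h => h5 ((val_H m _).2 h), h6, (val_E m _).1 h7⟩⟩, h8⟩
    · rintro ⟨v', ⟨i, h1, v, hv, h2, h3⟩, h4⟩
      refine ⟨i, fun h => h1 ((val_E i _).1 h), ⟨v, hv⟩, h2, ?_⟩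
      rcases h3 with ⟨h3, h5⟩ | ⟨h3, m, h5, h6, h7⟩
      · obtain rfl : v' = ⟨v, hv⟩ := Subtype.ext h5
        exact Or.inl ⟨(val_E i _).2 h3, h4⟩
      · refine Or.inr ⟨(val_H i _).2 h3, ?_⟩
        rw [mem_or3]
        exact ⟨m, fun h => h5 ((val_H m _).1 h), v', h6, (val_E m _).2 h7, h4⟩
  · rw [mem_and3]
    constructor
    · rintro h v' ⟨i, h1, v, hv, h2, h3⟩
      rcases h i with h | h
      · exact absurd ((val_E i _).1 h) h1
      · obtain ⟨ha, hb⟩ := h ⟨v, hv⟩ h2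
        rcases h3 with ⟨h3, h5⟩ | ⟨h3, m, h5, h6, h7⟩
        · obtain rfl : v' = ⟨v, hv⟩ := Subtype.ext h5
          rcases ha with ha | ha
          · exact absurd ((val_E i _).2 h3) ha
          · exact ha
        · rcases hb with hb | hb
          · exact absurd ((val_H i _).2 h3) hb
          · rw [mem_and3] at hb
            rcases hb m with hb | hb
            · exact absurd ((val_H m _).1 hb) h5
            · rcases hb v' h6 with hb | hb
              · exact absurd ((val_E m _).2 h7) hb
              · exact hb
    · intro h i
      by_cases h1 : isE i u.1
      · exact Or.inl ((val_E i _).2 h1)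
      · refine Or.inr fun v h2 => ⟨?_, ?_⟩
        · by_cases h3 : isE i v.1
          · exact Or.inr (h v ⟨i, h1, v.1, v.2, h2, Or.inl ⟨h3, rfl⟩⟩)
          · exact Or.inl fun h => h3 ((val_E i _).1 h)
        · by_cases h3 : isH i v.1
          · refine Or.inr ?_
            rw [mem_and3]
            intro m
            by_cases h4 : isH m v.1
            · exact Or.inl ((val_H m _).2 h4)
            · refine Or.inr fun v' h5 => ?_
              by_cases h6 : isE m v'.1
              · exact Or.inr (h v' ⟨i, h1, v.1, v.2, h2, Or.inr ⟨h3, m, h4, h5, h6⟩⟩)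
              · exact Or.inl fun h => h6 ((val_E m _).1 h)
          · exact Or.inl fun h => h3 ((val_H i _).1 h)

theorem stepA_game (x : NW C) (Z : Set (C.A.Q × NW C)) (t : Tr (Fin 3) C.A.Q ℕ) :
    stepA (NM C) (fun _ => ∅) x Z t ↔
      (own (val x.1) t ∧ ∃ p : C.A.Q × NW C, SuccA t x.1 (p.1, p.2.1) ∧ p ∈ Z) ∨
      (¬ own (val x.1) t ∧ ∀ p : C.A.Q × NW C, SuccA t x.1 (p.1, p.2.1) → p ∈ Z) := by
  cases t with
  | lit p b =>
    simp only [stepA, own, SuccA, shape, false_and, exists_false, and_false, false_or,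
      false_imp_iff, implies_true, and_true, not_not]
    rfl
  | leaf a => simp [stepA, own, SuccA, shape]
  | and q r =>
    simp only [stepA, own, SuccA, shape, false_and, false_or, not_false_iff, true_and]
    constructor
    · rintro ⟨h1, h2⟩ ⟨s, y⟩ (h | h)
      · obtain ⟨rfl, hy⟩ := Prod.mk.inj h
        obtain rfl : y = x := Subtype.ext hy
        exact h1
      · obtain ⟨rfl, hy⟩ := Prod.mk.inj h
        obtain rfl : y = x := Subtype.ext hy
        exact h2
    · intro h
      exact ⟨h (q, x) (Or.inl rfl), h (r, x) (Or.inr rfl)⟩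
  | or q r =>
    simp only [stepA, own, SuccA, shape, true_and, not_true, false_and, or_false]
    constructor
    · rintro (h | h)
      · exact ⟨(q, x), Or.inl rfl, h⟩
      · exact ⟨(r, x), Or.inr rfl, h⟩
    · rintro ⟨⟨s, y⟩, h | h, h'⟩
      · obtain ⟨rfl, hy⟩ := Prod.mk.inj h
        obtain rfl : y = x := Subtype.ext hy
        exact Or.inl h'
      · obtain ⟨rfl, hy⟩ := Prod.mk.inj h
        obtain rfl : y = x := Subtype.ext hy
        exact Or.inr h'
  | box m a =>
    simp only [stepA, own, SuccA, shape, false_and, false_or, not_false_iff, true_and]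
    constructor
    · rintro h ⟨s, y⟩ ⟨rfl, h'⟩
      exact h y h'
    · intro h v hv
      exact h (a, v) ⟨rfl, hv⟩
  | dia m a =>
    simp only [stepA, own, SuccA, shape, true_and, not_true, false_and, or_false]
    constructor
    · rintro ⟨v, hv, h⟩
      exact ⟨(a, v), ⟨rfl, hv⟩, h⟩
    · rintro ⟨⟨s, y⟩, ⟨rfl, h'⟩, h⟩
      exact ⟨y, h', h⟩

/-- Coding of game positions by live worlds. -/
def gg (u : NW C) (p : C.A.Q × NW C) : Prop := live u.1 = some (p.1, p.2.1)

theorem gg_fun (u : NW C) (p p') (h : gg u p) (h' : gg u p') : p = p' := by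
  unfold gg at h h'
  rw [h] at h'
  obtain ⟨h1, h2⟩ := Prod.mk.inj (Option.some.inj h')
  exact Prod.ext h1 (Subtype.ext h2)

theorem step_rel (hand : ∃ q r, C.A.δ C.A.q0 = .and q r) (n : ℕ) (hΩ : ∀ q, C.A.Ω q < n + 1)
    (Z : ℕ → Set (NW C)) (Z' : ℕ → Set (C.A.Q × NW C)) (h : ∀ j, Rel gg (Z j) (Z' j)) :
    Rel gg (sem (NM C) Z (bodyF n)) (C.A.T (NM C) (fun _ => ∅) Z') := by
  rintro u ⟨q, x⟩ hu
  have hl : live u.1 = some (q, x.1) := hu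
  show _ ↔ stepA (NM C) (fun _ => ∅) x (Z' (C.A.Ω q)) (C.A.δ q)
  rw [mem_bodyF, stepA_game]
  have e1 : (∃ j ≤ n, u ∈ (NM C).V (7 + j) ∧ u ∈ sem (NM C) Z (stepF j)) ↔
      u ∈ sem (NM C) Z (stepF (C.A.Ω q)) := by
    constructor
    · rintro ⟨j, _, h1, h2⟩
      rw [(val_pr hl j).1 h1]; exact h2
    · intro h2
      exact ⟨_, Nat.lt_succ_iff.1 (hΩ q), (val_pr hl _).2 rfl, h2⟩
  rw [e1, mem_stepF, val_own hand hl]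
  have forth : ∀ v' : NW C, Sc u.1 v'.1 → ∃ p : C.A.Q × NW C,
      gg v' p ∧ SuccA (C.A.δ q) x.1 (p.1, p.2.1) := by
    intro v' hs
    obtain ⟨⟨p1, p2⟩, h1, h2⟩ := Sc_forth v'.2 hl x.2 hs
    have hv : Valid p2 := by
      have := valid_cod v'.2
      revert this h1
      cases v'.1 with
      | root => intro h1 h2; simp [live] at h1; rw [← h1.2]; exact h2
      | lv => intro h1 h2; simp [live] at h1; rw [← h1.2]; exact h2
      | _ => intro h1; simp [live] at h1
    exact ⟨(p1, ⟨p2, hv⟩), h1, h2⟩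
  have back : ∀ p : C.A.Q × NW C, SuccA (C.A.δ q) x.1 (p.1, p.2.1) →
      ∃ v' : NW C, gg v' p ∧ Sc u.1 v'.1 := by
    intro p hp
    obtain ⟨v', h1, h2, h3⟩ := Sc_back u.2 hl x.2 (p := (p.1, p.2.1)) p.2.2 hp
    exact ⟨⟨v', h1⟩, h2, h3⟩
  refine or_congr (and_congr_right fun _ => ?_) (and_congr_right fun _ => ?_)
  · constructor
    · rintro ⟨v', hs, hv⟩
      obtain ⟨p, h1, h2⟩ := forth v' hs
      exact ⟨p, h2, (h _ _ _ h1).1 hv⟩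
    · rintro ⟨p, hs, hv⟩
      obtain ⟨v', h1, h2⟩ := back p hs
      exact ⟨v', h2, (h _ _ _ h1).2 hv⟩
  · constructor
    · intro hh p hs
      obtain ⟨v', h1, h2⟩ := back p hs
      exact (h _ _ _ h1).1 (hh v' h2)
    · intro hh v' hs
      obtain ⟨p, h1, h2⟩ := forth v' hs
      exact (h _ _ _ h1).2 (hh p h2)

def rt : NW C := ⟨.root, .root⟩

theorem root_iff (hand : ∃ q r, C.A.δ C.A.q0 = .and q r) (n : ℕ) (hΩ : ∀ q, C.A.Ω q < n + 1) :
    (rt : NW C) ∈ sem (NM C) (fun _ => Set.univ) (bindF (bodyF n) (n + 1)) ↔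
      (rt : NW C) ∈ C.A.acc (NM C) (fun _ => ∅) (n + 1) (fun _ => Set.univ) := by
  rw [sem_bindF]
  exact nest_rel (g := gg (C := C)) gg_fun (K := n + 1) (fun _ _ => True) (by intros; trivial)
    (sem_monoE (NM C) (bodyF n)) (C.A.T_monoT (NM C) _)
    (fun Z Z' _ h => step_rel hand n hΩ Z Z' h) (n + 1) le_rfl _ _ trivial
    (by intro j u p _; simp) rt (C.A.q0, rt) rfl

/-- The frame of the model. -/
def NF (C : Ctx) : Frame (Fin 3) := ⟨NW C, (NM C).R⟩

theorem reduct_mem (i : Fin 3) (K : Set (Frame Unit)) (hiso : ClosedUnderIso K)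
    (hdu : ClosedUnderDU K) (hF : (⟨C.F i, fun _ => C.FR i⟩ : Frame Unit) ∈ K) :
    (NF C).reduct3 i ∈ K := by
  let ι : Type := {u : Raw C // Valid u ∧ entry u ≠ some i}
  refine hiso _ (hdu ι (fun _ => ⟨C.F i, fun _ => C.FR i⟩) (fun _ => hF)) _ ?_
  let e : (Σ _ : ι, C.F i) ≃ NW C :=
    { toFun := fun p => ⟨mk p.1.1 i p.2, valid_mk p.1.2.1 p.1.2.2 _⟩
      invFun := fun u => ⟨⟨base u.1 i, valid_base u.2 i, entry_base u.2 i⟩, pos u.1 i⟩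
      left_inv := by
        rintro ⟨⟨c, hc1, hc2⟩, y⟩
        have h1 : base (mk c i y) i = c := base_mk hc2 y
        have h2 : pos (mk c i y) i = y := pos_mk y
        simp only [h1, h2]
      right_inv := by
        rintro ⟨u, hu⟩
        exact Subtype.ext (mk_base hu i) }
  refine ⟨e, ?_⟩
  rintro _ ⟨⟨c, hc⟩, y⟩ ⟨⟨c', hc'⟩, y'⟩
  show (∃ h : (⟨c, hc⟩ : ι) = ⟨c', hc'⟩, C.FR i y y') ↔
    base (mk c i y) i = base (mk c' i y') i ∧ C.FR i (pos (mk c i y) i) (pos (mk c' i y') i)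
  rw [base_mk hc.2, base_mk hc'.2, pos_mk, pos_mk]
  simp [Subtype.ext_iff]

end model

theorem main_strict
    (C0 C1 C2 : Set (Frame Unit))
    (h0iso : ClosedUnderIso C0) (h0du : ClosedUnderDU C0)
    (h1iso : ClosedUnderIso C1) (h1du : ClosedUnderDU C1)
    (h2iso : ClosedUnderIso C2) (h2du : ClosedUnderDU C2)
    (he0 : HasEdge C0) (he1 : HasEdge C1) (he2 : HasEdge C2) :
    ∀ n : ℕ, ∃ φ : MuForm (Fin 3), (SigmaMu (n + 1) φ ∨ PiMu (n + 1) φ) ∧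
      ∀ ψ : MuForm (Fin 3), (SigmaMu n ψ ∨ PiMu n ψ) →
        ¬ EquivOver (fusion3 C0 C1 C2) φ ψ := by
  intro n
  refine ⟨bindF (bodyF n) (n + 1), ?_, ?_⟩
  · by_cases hn : Even n
    · exact Or.inr ((bindF_class (bodyF_noFix n) n).1 hn)
    · exact Or.inl ((bindF_class (bodyF_noFix n) n).2 hn)
  · intro ψ hψ heq
    have hd : SigmaMu n (dual ψ) ∨ PiMu n (dual ψ) := by
      rcases hψ with h | h
      · exact Or.inr (sigma_dual h)
      · exact Or.inl (pi_dual h)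
    obtain ⟨A, hΩ, hand, hacc⟩ := rep_start (all_rep hd)
    have hch : ∀ i : Fin 3, ∃ F : Frame Unit, F ∈ (![C0, C1, C2] i) ∧
        ∃ w0 w1 : F.World, w0 ≠ w1 ∧ F.R () w0 w1 := by
      intro i
      fin_cases i
      · exact he0
      · exact he1
      · exact he2
    choose G hG w0 w1 hne hR using hch
    let C : Ctx := ⟨fun i => (G i).World, fun i => (G i).R (), w0, w1, hne, hR, A⟩
    have hmem : NF C ∈ fusion3 C0 C1 C2 :=
      ⟨reduct_mem 0 C0 h0iso h0du (hG 0), reduct_mem 1 C1 h1iso h1du (hG 1),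
        reduct_mem 2 C2 h2iso h2du (hG 2)⟩
    have h1 : MuForm.sem (NM C) (fun _ => Set.univ) (bindF (bodyF n) (n + 1))
        = MuForm.sem (NM C) (fun _ => Set.univ) ψ := heq (NF C) hmem (NM C).V (fun _ => Set.univ)
    have h2 := root_iff (C := C) hand n hΩ
    rw [h1, hacc _ (NM C) (fun _ => ∅) (fun _ => Set.univ), sem_dual] at h2
    simp only [Set.compl_empty, Set.mem_compl_iff] at h2
    tauto

end AHS

/-- If `∘→∘` is a subframe of each of `F₀`, `F₁`, `F₂`, classes
of unimodal frames closed under isomorphic copies and disjoint unions, then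
the μ-calculus' alternation hierarchy is strict over `F₀ ⊗ F₁ ⊗ F₂`. -/
theorem alternation_hierarchy_strict_three_edges
    (C0 C1 C2 : Set (Frame Unit))
    (h0iso : ClosedUnderIso C0) (h0du : ClosedUnderDU C0)
    (h1iso : ClosedUnderIso C1) (h1du : ClosedUnderDU C1)
    (h2iso : ClosedUnderIso C2) (h2du : ClosedUnderDU C2)
    (he0 : HasEdge C0) (he1 : HasEdge C1) (he2 : HasEdge C2) :
    ∀ n : ℕ, ∃ φ : MuForm (Fin 3), (SigmaMu (n + 1) φ ∨ PiMu (n + 1) φ) ∧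
      ∀ ψ : MuForm (Fin 3), (SigmaMu n ψ ∨ PiMu n ψ) →
        ¬ EquivOver (fusion3 C0 C1 C2) φ ψ := by
  exact AHS.main_strict C0 C1 C2 h0iso h0du h1iso h1du h2iso h2du he0 he1 he2
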